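/- arXiv:2003.00652 — 5 statements merged into one kernel-verified Lean document; each statement's English description precedes it below -/
import Mathlib

section
/- Let P and Q be probability measures on Ω₁×⋯×Ω_n (standard Borel spaces) that are both Bayes-nets with respect to a common DAG G with topological ordering (1,…,n) and parent sets Π_i ⊆ {1,…,i−1}. Then the squared Hellinger distance satisfies H²(P,Q) ≤ Σ_{i=1}^n H²(P_{X_i∪X_{Π_i}}, Q_{X_i∪X_{Π_i}}). -/
open MeasureTheory ProbabilityTheory Filter
open scoped ENNReal NNReal

noncomputable section

universe u

/-- Projection of a point of a product space onto the coordinates in `S`. -/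
def proj {n : ℕ} {Ω : Fin n → Type*} (S : Finset (Fin n)) (x : ∀ i, Ω i) (i : S) : Ω i := x i

lemma measurable_proj {n : ℕ} {Ω : Fin n → Type*} [∀ i, MeasurableSpace (Ω i)]
    (S : Finset (Fin n)) : Measurable (proj (Ω := Ω) S) :=
  measurable_pi_lambda _ fun _ => measurable_pi_apply _

/-- A finite measure `P` on a product of standard Borel spaces is a Bayes-net with respect to
the parent structure `par` (for the topological ordering `0 < 1 < ⋯ < n-1`) if, for every `i`,
the `i`-th coordinate is conditionally independent of the tuple of previous coordinates given
the tuple of parent coordinates `par i`. -/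
def IsBayesNet {n : ℕ} {Ω : Fin n → Type*} [∀ i, MeasurableSpace (Ω i)]
    [∀ i, StandardBorelSpace (Ω i)] [∀ i, Nonempty (Ω i)]
    (P : Measure (∀ i, Ω i)) [IsFiniteMeasure P] (par : Fin n → Finset (Fin n)) : Prop :=
  ∀ i : Fin n,
    CondIndepFun (MeasurableSpace.comap (proj (par i)) inferInstance)
      ((measurable_proj (par i)).comap_le) (fun x => x i) (proj (Finset.Iio i)) P

/-- The squared Hellinger distance `H²(P,Q) = (1/2) ∫ (√(dP/dμ) - √(dQ/dμ))² dμ`, computed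
with the dominating measure `μ = P + Q` (the value does not depend on the choice of a
dominating measure). -/
def sqHellinger {Ω : Type*} [MeasurableSpace Ω] (P Q : Measure Ω) : ℝ :=
  (1/2) * ∫ x, (Real.sqrt ((P.rnDeriv (P + Q) x).toReal)
    - Real.sqrt ((Q.rnDeriv (P + Q) x).toReal)) ^ 2 ∂(P + Q)

section Affinity

variable {α β γ : Type*} [MeasurableSpace α] [MeasurableSpace β] [MeasurableSpace γ]

lemma two_mul_rpow_half_le_add (a b : ℝ≥0∞) : 2 * (a * b) ^ (1 / 2 : ℝ) ≤ a + b := by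
  have h := ENNReal.young_inequality (a ^ (1 / 2 : ℝ)) (b ^ (1 / 2 : ℝ))
    Real.HolderConjugate.two_two
  rw [← ENNReal.rpow_mul, ← ENNReal.rpow_mul, ← ENNReal.mul_rpow_of_nonneg _ _ (by norm_num)] at h
  norm_num at h
  rw [← ENNReal.add_div, ENNReal.le_div_iff_mul_le (by simp) (by simp)] at h
  rwa [mul_comm]

lemma rpow_half_mul_self_mul (a b c : ℝ≥0∞) :
    (a * b) ^ (1 / 2 : ℝ) * c = (a * c * (b * c)) ^ (1 / 2 : ℝ) := by
  rw [mul_mul_mul_comm, ENNReal.mul_rpow_of_nonneg (a * b) (c * c) (by norm_num), ← sq c,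
    ← ENNReal.rpow_natCast, ← ENNReal.rpow_mul]
  norm_num

/-- The Hellinger affinity of `P` and `Q`, weighted by `g`, for the dominating measure `P + Q`. -/
def affinity (g : α → ℝ≥0∞) (P Q : Measure α) : ℝ≥0∞ :=
  ∫⁻ x, g x * (P.rnDeriv (P + Q) x * Q.rnDeriv (P + Q) x) ^ (1 / 2 : ℝ) ∂(P + Q)

lemma withDensity_rnDeriv_add_left (P Q : Measure α) [IsFiniteMeasure P] [IsFiniteMeasure Q] :
    (P + Q).withDensity (P.rnDeriv (P + Q)) = P :=
  Measure.withDensity_rnDeriv_eq _ _ (Measure.AbsolutelyContinuous.rfl.add_right Q)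

lemma withDensity_rnDeriv_add_right (P Q : Measure α) [IsFiniteMeasure P] [IsFiniteMeasure Q] :
    (P + Q).withDensity (Q.rnDeriv (P + Q)) = Q := by
  refine Measure.withDensity_rnDeriv_eq _ _ ?_
  rw [add_comm]
  exact Measure.AbsolutelyContinuous.rfl.add_right P

lemma affinity_eq_lintegral {m P Q : Measure α} [IsFiniteMeasure P] [IsFiniteMeasure Q]
    [SigmaFinite m] {p q g : α → ℝ≥0∞} (hp : Measurable p) (hq : Measurable q) (hg : Measurable g)
    (hP : P = m.withDensity p) (hQ : Q = m.withDensity q) :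
    affinity g P Q = ∫⁻ x, g x * (p x * q x) ^ (1 / 2 : ℝ) ∂m := by
  have hR : P + Q = m.withDensity (p + q) := by rw [hP, hQ, withDensity_add_left hp]
  have key {T : Measure α} {t r : α → ℝ≥0∞} (ht : Measurable t) (hr : Measurable r)
      (hT : T = m.withDensity t) [IsFiniteMeasure T] (h : (P + Q).withDensity r = T) :
      (p + q) * r =ᵐ[m] t := by
    refine (withDensity_eq_iff_of_sigmaFinite ((hp.add hq).mul hr).aemeasurable
      ht.aemeasurable).1 ?_
    rw [withDensity_mul _ (hp.add hq) hr, ← hR, h, hT]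
  have hpm : Measurable (P.rnDeriv (P + Q)) := Measure.measurable_rnDeriv _ _
  have hqm : Measurable (Q.rnDeriv (P + Q)) := Measure.measurable_rnDeriv _ _
  have h1 := key hp hpm hP (withDensity_rnDeriv_add_left P Q)
  have h2 := key hq hqm hQ (withDensity_rnDeriv_add_right P Q)
  unfold affinity
  generalize P.rnDeriv (P + Q) = p' at *
  generalize Q.rnDeriv (P + Q) = q' at *
  rw [hR, lintegral_withDensity_eq_lintegral_mul _ (hp.add hq) (by fun_prop)]
  refine lintegral_congr_ae ?_
  filter_upwards [h1, h2] with x h1 h2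
  rw [← h1, ← h2]
  simp only [Pi.mul_apply]
  rw [mul_comm _ (p' x), mul_comm ((p + q) x) (q' x), ← rpow_half_mul_self_mul]
  ring

lemma lintegral_rpow_half_le_one {m : Measure α} {p q : α → ℝ≥0∞} (hp : Measurable p)
    (hq : Measurable q) (hp1 : ∫⁻ x, p x ∂m ≤ 1) (hq1 : ∫⁻ x, q x ∂m ≤ 1) :
    ∫⁻ x, (p x * q x) ^ (1 / 2 : ℝ) ∂m ≤ 1 := by
  have h := ENNReal.lintegral_mul_norm_pow_le hp.aemeasurable hq.aemeasurable
    (μ := m) (p := 1 / 2) (q := 1 / 2) (by norm_num) (by norm_num) (by norm_num)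
  simp_rw [← ENNReal.mul_rpow_of_nonneg _ _ (by norm_num : (0 : ℝ) ≤ 1 / 2)] at h
  exact h.trans (ENNReal.rpow_le_one (mul_le_one' hp1 hq1) (by norm_num))

lemma affinity_one_le (P Q : Measure α) [IsProbabilityMeasure P] [IsProbabilityMeasure Q] :
    affinity (fun _ => 1) P Q ≤ 1 := by
  simp only [affinity, one_mul]
  refine lintegral_rpow_half_le_one (Measure.measurable_rnDeriv _ _)
    (Measure.measurable_rnDeriv _ _) ?_ ?_
  · exact (Measure.lintegral_rnDeriv_le).trans (by simp)
  · exact (Measure.lintegral_rnDeriv_le).trans (by simp)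

lemma affinity_add {g h : α → ℝ≥0∞} (hg : Measurable g) (P Q : Measure α) :
    affinity (fun x => g x + h x) P Q = affinity g P Q + affinity h P Q := by
  simp only [affinity, add_mul]
  exact lintegral_add_left (hg.mul (((Measure.measurable_rnDeriv _ _).mul
    (Measure.measurable_rnDeriv _ _)).pow_const _)) _

lemma sqHellinger_eq_one_sub (P Q : Measure α) [IsProbabilityMeasure P] [IsProbabilityMeasure Q] :
    sqHellinger P Q = 1 - (affinity (fun _ => 1) P Q).toReal := by
  set p := P.rnDeriv (P + Q) with hp
  set q := Q.rnDeriv (P + Q) with hq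
  have hpm : Measurable p := Measure.measurable_rnDeriv _ _
  have hqm : Measurable q := Measure.measurable_rnDeriv _ _
  have hA : ∫⁻ x, (p x * q x) ^ (1 / 2 : ℝ) ∂(P + Q) ≤ 1 := by
    simpa [affinity] using affinity_one_le P Q
  have hp1 : ∫ x, (p x).toReal ∂(P + Q) = 1 := by
    rw [Measure.integral_toReal_rnDeriv (Measure.AbsolutelyContinuous.rfl.add_right Q)]
    simp
  have hq1 : ∫ x, (q x).toReal ∂(P + Q) = 1 := by
    rw [Measure.integral_toReal_rnDeriv
      (add_comm P Q ▸ Measure.AbsolutelyContinuous.rfl.add_right P)]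
    simp
  have hrm : Measurable fun x => (p x * q x) ^ (1 / 2 : ℝ) := (hpm.mul hqm).pow_const _
  have hr : ∫ x, ((p x * q x) ^ (1 / 2 : ℝ)).toReal ∂(P + Q)
      = (affinity (fun _ => 1) P Q).toReal := by
    rw [integral_toReal hrm.aemeasurable
      (ae_lt_top hrm (hA.trans_lt ENNReal.one_lt_top).ne)]
    simp [affinity, hp, hq]
  have hri : Integrable (fun x => ((p x * q x) ^ (1 / 2 : ℝ)).toReal) (P + Q) :=
    integrable_toReal_of_lintegral_ne_top hrm.aemeasurable (hA.trans_lt ENNReal.one_lt_top).ne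
  have hpi : Integrable (fun x => (p x).toReal) (P + Q) := Measure.integrable_toReal_rnDeriv
  have hqi : Integrable (fun x => (q x).toReal) (P + Q) := Measure.integrable_toReal_rnDeriv
  have hpt (x : α) : (Real.sqrt (p x).toReal - Real.sqrt (q x).toReal) ^ 2
      = (p x).toReal + (q x).toReal - 2 * ((p x * q x) ^ (1 / 2 : ℝ)).toReal := by
    rw [← ENNReal.toReal_rpow, ENNReal.toReal_mul, ← Real.sqrt_eq_rpow,
      Real.sqrt_mul ENNReal.toReal_nonneg, sub_sq, Real.sq_sqrt ENNReal.toReal_nonneg,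
      Real.sq_sqrt ENNReal.toReal_nonneg]
    ring
  unfold sqHellinger
  simp_rw [← hp, ← hq, hpt]
  rw [integral_sub (f := fun x => (p x).toReal + (q x).toReal) (hpi.add hqi) (hri.const_mul 2),
    integral_add hpi hqi, integral_const_mul,
    hp1, hq1, hr]
  ring

/-- Conditional Cauchy-Schwarz: the affinity does not decrease under a measurable map. -/
lemma affinity_comp_le_map {f : α → β} (hf : Measurable f) {g : β → ℝ≥0∞} (hg : Measurable g)
    (P Q : Measure α) [IsFiniteMeasure P] [IsFiniteMeasure Q] :
    affinity (fun x => g (f x)) P Q ≤ affinity g (P.map f) (Q.map f) := by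
  set p := P.rnDeriv (P + Q) with hp
  set q := Q.rnDeriv (P + Q) with hq
  set p' := (P.map f).rnDeriv (P.map f + Q.map f) with hp'
  set q' := (Q.map f).rnDeriv (P.map f + Q.map f) with hq'
  have hpm : Measurable p := Measure.measurable_rnDeriv _ _
  have hqm : Measurable q := Measure.measurable_rnDeriv _ _
  have hpm' : Measurable p' := Measure.measurable_rnDeriv _ _
  have hqm' : Measurable q' := Measure.measurable_rnDeriv _ _
  have hPd := withDensity_rnDeriv_add_left P Q
  have hQd := withDensity_rnDeriv_add_right P Q
  have hPd' := withDensity_rnDeriv_add_left (P.map f) (Q.map f)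
  have hQd' := withDensity_rnDeriv_add_right (P.map f) (Q.map f)
  have htop {T : Measure β} [IsFiniteMeasure T] :
      ∀ᵐ y ∂(P.map f + Q.map f), T.rnDeriv (P.map f + Q.map f) y < ∞ := Measure.rnDeriv_lt_top _ _
  have hmap : (P + Q).map f = P.map f + Q.map f := Measure.map_add _ _ hf
  -- a density vanishes almost everywhere on the fibres where the density of the image does
  have hzero {T : Measure α} {t : α → ℝ≥0∞} {t' : β → ℝ≥0∞} (ht : Measurable t)
      (ht' : Measurable t') (hT : (P + Q).withDensity t = T)
      (hT' : (P.map f + Q.map f).withDensity t' = T.map f) :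
      ∀ᵐ x ∂(P + Q), t' (f x) = 0 → t x = 0 := by
    have h1 : ∀ᵐ y ∂(T.map f), t' y ≠ 0 := by
      rw [← hT', ae_withDensity_iff ht']
      exact ae_of_all _ fun _ h => h
    have h2 := ae_of_ae_map hf.aemeasurable h1
    rw [← hT, ae_withDensity_iff ht] at h2
    filter_upwards [h2] with x hx h0
    by_contra hne
    exact hx hne h0
  have hint {T : Measure α} {t : α → ℝ≥0∞} {t' : β → ℝ≥0∞} (ht : Measurable t)
      (ht' : Measurable t') (hT : (P + Q).withDensity t = T)
      (hT' : (P.map f + Q.map f).withDensity t' = T.map f) {h : β → ℝ≥0∞} (hh : Measurable h) :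
      ∫⁻ x, h (f x) * t x ∂(P + Q) = ∫⁻ y, h y * t' y ∂(P.map f + Q.map f) := by
    have h1 := lintegral_withDensity_eq_lintegral_mul (P + Q) ht (hh.comp hf)
    have h2 := lintegral_withDensity_eq_lintegral_mul (P.map f + Q.map f) ht' hh
    rw [hT] at h1
    rw [hT', lintegral_map hh hf] at h2
    simp only [Pi.mul_apply, Function.comp_apply] at h1 h2
    simp_rw [mul_comm (h _)]
    rw [← h1, ← h2]
  have hpos : ∀ᵐ x ∂(P + Q), 2 * (g (f x) * (p x * q x) ^ (1 / 2 : ℝ))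
      ≤ g (f x) * (q' (f x) / p' (f x)) ^ (1 / 2 : ℝ) * p x
        + g (f x) * (p' (f x) / q' (f x)) ^ (1 / 2 : ℝ) * q x := by
    have t1 : ∀ᵐ x ∂(P + Q), p' (f x) < ∞ :=
      ae_of_ae_map (p := fun y => p' y < ∞) hf.aemeasurable (by rw [hmap]; exact htop)
    have t2 : ∀ᵐ x ∂(P + Q), q' (f x) < ∞ :=
      ae_of_ae_map (p := fun y => q' y < ∞) hf.aemeasurable (by rw [hmap]; exact htop)
    filter_upwards [hzero hpm hpm' hPd hPd', hzero hqm hqm' hQd hQd', t1, t2] with x h1 h2 t1 t2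
    by_cases hp0 : p' (f x) = 0
    · simp [h1 hp0]
    by_cases hq0 : q' (f x) = 0
    · simp [h2 hq0]
    generalize p' (f x) = a at *
    generalize q' (f x) = b at *
    rw [mul_assoc, mul_assoc, ← mul_add, mul_left_comm]
    gcongr
    have h := two_mul_rpow_half_le_add ((b / a) ^ (1 / 2 : ℝ) * p x) ((a / b) ^ (1 / 2 : ℝ) * q x)
    have hba : (b / a) ^ (1 / 2 : ℝ) * (a / b) ^ (1 / 2 : ℝ) = 1 := by
      rw [← ENNReal.mul_rpow_of_nonneg _ _ (by norm_num), div_eq_mul_inv, div_eq_mul_inv,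
        mul_assoc, ← mul_assoc a⁻¹, ENNReal.inv_mul_cancel hp0 t1.ne, one_mul,
        ENNReal.mul_inv_cancel hq0 t2.ne, ENNReal.one_rpow]
    rwa [mul_mul_mul_comm, hba, one_mul] at h
  have hle (a b : ℝ≥0∞) (ha : a < ∞) : (b / a) ^ (1 / 2 : ℝ) * a ≤ (a * b) ^ (1 / 2 : ℝ) := by
    by_cases h0 : a = 0
    · simp [h0]
    rw [div_eq_mul_inv, mul_comm b, rpow_half_mul_self_mul, ENNReal.inv_mul_cancel h0 ha.ne,
      one_mul, mul_comm]
  have h2 : 2 * affinity (fun x => g (f x)) P Q ≤ 2 * affinity g (P.map f) (Q.map f) := by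
    unfold affinity
    rw [← lintegral_const_mul _ (by fun_prop)]
    refine (lintegral_mono_ae hpos).trans ?_
    rw [lintegral_add_left (by fun_prop),
      hint hpm hpm' hPd hPd' (h := fun y => g y * (q' y / p' y) ^ (1 / 2 : ℝ)) (by fun_prop),
      hint hqm hqm' hQd hQd' (h := fun y => g y * (p' y / q' y) ^ (1 / 2 : ℝ)) (by fun_prop),
      two_mul]
    refine add_le_add (lintegral_mono_ae ?_) (lintegral_mono_ae ?_)
    · filter_upwards [htop (T := P.map f)] with y hy
      rw [mul_assoc]
      gcongr
      exact hle _ _ hy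
    · filter_upwards [htop (T := Q.map f)] with y hy
      rw [mul_assoc, ← hp', ← hq', mul_comm (p' y) (q' y)]
      gcongr
      exact hle _ _ hy
  exact (ENNReal.mul_le_mul_iff_right (by simp) (by simp)).1 h2

lemma sqHellinger_map_le {f : α → β} (hf : Measurable f) (P Q : Measure α)
    [IsProbabilityMeasure P] [IsProbabilityMeasure Q] :
    sqHellinger (P.map f) (Q.map f) ≤ sqHellinger P Q := by
  have := Measure.isProbabilityMeasure_map (μ := P) hf.aemeasurable
  have := Measure.isProbabilityMeasure_map (μ := Q) hf.aemeasurable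
  rw [sqHellinger_eq_one_sub, sqHellinger_eq_one_sub]
  have h := affinity_comp_le_map hf (g := fun _ => 1) measurable_const P Q
  have := ENNReal.toReal_mono
    ((affinity_one_le (P.map f) (Q.map f)).trans_lt ENNReal.one_lt_top).ne h
  linarith

lemma sqHellinger_map_comp_le {f : α → β} (hf : Measurable f) {g : β → γ} (hg : Measurable g)
    (P Q : Measure α) [IsProbabilityMeasure P] [IsProbabilityMeasure Q] :
    sqHellinger (P.map fun x => g (f x)) (Q.map fun x => g (f x))
      ≤ sqHellinger (P.map f) (Q.map f) := by
  have := Measure.isProbabilityMeasure_map (μ := P) hf.aemeasurable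
  have := Measure.isProbabilityMeasure_map (μ := Q) hf.aemeasurable
  have h := sqHellinger_map_le hg (P.map f) (Q.map f)
  rwa [Measure.map_map hg hf, Measure.map_map hg hf] at h

lemma compProd_withDensity_withDensity {m μ : Measure α} [SFinite m] [SFinite μ]
    {M K : Kernel α β} [IsSFiniteKernel M] [IsSFiniteKernel K] {p : α → ℝ≥0∞}
    {k : α → β → ℝ≥0∞} (hp : Measurable p) (hk : Measurable (Function.uncurry k))
    (hμ : μ = m.withDensity p) (hK : ∀ a, K a = (M a).withDensity (k a)) :
    μ ⊗ₘ K = (m ⊗ₘ M).withDensity (fun x => p x.1 * k x.1 x.2) := by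
  have hd : Measurable fun x : α × β => p x.1 * k x.1 x.2 := (hp.comp measurable_fst).mul hk
  refine Measure.ext_of_lintegral _ fun h hh => ?_
  have hin : Measurable fun a => ∫⁻ b, h (a, b) ∂(K a) := hh.lintegral_kernel_prod_right'
  rw [Measure.lintegral_compProd hh, lintegral_withDensity_eq_lintegral_mul _ hd hh,
    Measure.lintegral_compProd (hd.mul hh)]
  conv_lhs => rw [hμ, lintegral_withDensity_eq_lintegral_mul _ hp hin]
  refine lintegral_congr fun a => ?_
  have hka : Measurable (k a) := hk.comp measurable_prodMk_left
  have hha : Measurable fun b => h (a, b) := hh.comp measurable_prodMk_left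
  rw [Pi.mul_apply, hK a, lintegral_withDensity_eq_lintegral_mul _ hka hha,
    ← lintegral_const_mul _ (hka.mul hha)]
  simp only [Pi.mul_apply, mul_assoc]

lemma affinity_compProd {μ ν : Measure α} [IsFiniteMeasure μ] [IsFiniteMeasure ν]
    {M K L : Kernel α β} [IsFiniteKernel M] [IsFiniteKernel K] [IsFiniteKernel L]
    {k l : α → β → ℝ≥0∞} (hk : Measurable (Function.uncurry k))
    (hl : Measurable (Function.uncurry l)) (hK : ∀ a, K a = (M a).withDensity (k a))
    (hL : ∀ a, L a = (M a).withDensity (l a)) :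
    affinity (fun _ => 1) (μ ⊗ₘ K) (ν ⊗ₘ L)
      = affinity (fun a => ∫⁻ b, (k a b * l a b) ^ (1 / 2 : ℝ) ∂(M a)) μ ν := by
  have hpm : Measurable (μ.rnDeriv (μ + ν)) := Measure.measurable_rnDeriv _ _
  have hqm : Measurable (ν.rnDeriv (μ + ν)) := Measure.measurable_rnDeriv _ _
  have hd {p : α → ℝ≥0∞} {k : α → β → ℝ≥0∞} (hp : Measurable p)
      (hk : Measurable (Function.uncurry k)) : Measurable fun x : α × β => p x.1 * k x.1 x.2 :=
    (hp.comp measurable_fst).mul hk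
  have hpq : Measurable fun x : α × β => 1 * (μ.rnDeriv (μ + ν) x.1 * k x.1 x.2 *
      (ν.rnDeriv (μ + ν) x.1 * l x.1 x.2)) ^ (1 / 2 : ℝ) :=
    measurable_const.mul (((hd hpm hk).mul (hd hqm hl)).pow_const _)
  rw [affinity_eq_lintegral (m := (μ + ν) ⊗ₘ M) (hd hpm hk) (hd hqm hl) measurable_const
    (compProd_withDensity_withDensity hpm hk (withDensity_rnDeriv_add_left μ ν).symm hK)
    (compProd_withDensity_withDensity hqm hl (withDensity_rnDeriv_add_right μ ν).symm hL),
    Measure.lintegral_compProd hpq]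
  refine lintegral_congr fun a => ?_
  have hka : Measurable (k a) := hk.comp measurable_prodMk_left
  have hla : Measurable (l a) := hl.comp measurable_prodMk_left
  beta_reduce
  rw [← lintegral_mul_const _ (by fun_prop)]
  refine lintegral_congr fun b => ?_
  rw [one_mul, mul_mul_mul_comm, ENNReal.mul_rpow_of_nonneg _ _ (by norm_num), mul_comm]

/-- Subadditivity of the squared Hellinger distance for two laws whose conditional law of the
second coordinate given the first one depends on the first one through `f` only. -/
lemma sqHellinger_compProd_comap_le [MeasurableSpace.CountablyGenerated γ] {f : α → β}
    (hf : Measurable f) (μ ν : Measure α) [IsProbabilityMeasure μ] [IsProbabilityMeasure ν]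
    (κ η : Kernel β γ) [IsMarkovKernel κ] [IsMarkovKernel η] :
    sqHellinger (μ ⊗ₘ κ.comap f hf) (ν ⊗ₘ η.comap f hf)
      ≤ sqHellinger μ ν + sqHellinger (μ.map f ⊗ₘ κ) (ν.map f ⊗ₘ η) := by
  have := Measure.isProbabilityMeasure_map (μ := μ) hf.aemeasurable
  have := Measure.isProbabilityMeasure_map (μ := ν) hf.aemeasurable
  set k := Kernel.rnDeriv κ (κ + η)
  set l := Kernel.rnDeriv η (κ + η)
  have hk : Measurable (Function.uncurry k) := Kernel.measurable_rnDeriv _ _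
  have hl : Measurable (Function.uncurry l) := Kernel.measurable_rnDeriv _ _
  have hκ (b : β) : κ b = ((κ + η) b).withDensity (k b) := by
    rw [withDensity_congr_ae Kernel.rnDeriv_eq_rnDeriv_measure]
    exact (withDensity_rnDeriv_add_left (κ b) (η b)).symm
  have hη (b : β) : η b = ((κ + η) b).withDensity (l b) := by
    rw [withDensity_congr_ae Kernel.rnDeriv_eq_rnDeriv_measure]
    exact (withDensity_rnDeriv_add_right (κ b) (η b)).symm
  set A : β → ℝ≥0∞ := fun b => ∫⁻ c, (k b c * l b c) ^ (1 / 2 : ℝ) ∂((κ + η) b)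
  have hAm : Measurable A := ((hk.mul hl).pow_const _).lintegral_kernel_prod_right'
  have hA1 (b : β) : A b ≤ 1 := by
    refine lintegral_rpow_half_le_one (hk.comp measurable_prodMk_left)
      (hl.comp measurable_prodMk_left) ?_ ?_
    · rw [← setLIntegral_univ, ← withDensity_apply _ .univ, ← hκ, measure_univ]
    · rw [← setLIntegral_univ, ← withDensity_apply _ .univ, ← hη, measure_univ]
  have hf2 : Measurable fun x : α × γ => (f x.1, x.2) := by fun_prop
  have e1 : affinity (fun _ => 1) (μ ⊗ₘ κ.comap f hf) (ν ⊗ₘ η.comap f hf)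
      = affinity (fun a => A (f a)) μ ν :=
    affinity_compProd (M := (κ + η).comap f hf) (k := fun a => k (f a)) (l := fun a => l (f a))
      (hk.comp hf2) (hl.comp hf2) (fun a => hκ (f a)) (fun a => hη (f a))
  have e2 : affinity (fun _ => 1) (μ.map f ⊗ₘ κ) (ν.map f ⊗ₘ η)
      = affinity A (μ.map f) (ν.map f) := affinity_compProd hk hl hκ hη
  have hsplit (b : β) : A b + (1 - A b) = 1 := add_tsub_cancel_of_le (hA1 b)
  have key : affinity (fun _ => 1) μ ν + affinity A (μ.map f) (ν.map f)
      ≤ affinity (fun a => A (f a)) μ ν + 1 := by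
    calc affinity (fun _ => 1) μ ν + affinity A (μ.map f) (ν.map f)
        = affinity (fun a => A (f a)) μ ν + affinity (fun a => 1 - A (f a)) μ ν
            + affinity A (μ.map f) (ν.map f) := by
          rw [← affinity_add (g := fun a => A (f a)) (hAm.comp hf)]
          simp only [hsplit]
      _ ≤ affinity (fun a => A (f a)) μ ν + affinity (fun b => 1 - A b) (μ.map f) (ν.map f)
            + affinity A (μ.map f) (ν.map f) := by
          gcongr
          exact affinity_comp_le_map hf (g := fun b => 1 - A b) (measurable_const.sub hAm) μ ν
      _ = affinity (fun a => A (f a)) μ ν + affinity (fun _ => 1) (μ.map f) (ν.map f) := by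
          rw [add_assoc, add_comm (affinity (fun b => 1 - A b) _ _), ← affinity_add hAm]
          simp only [hsplit]
      _ ≤ _ := by
          gcongr
          exact affinity_one_le _ _
  rw [sqHellinger_eq_one_sub, sqHellinger_eq_one_sub, sqHellinger_eq_one_sub, e1, e2]
  have n1 : affinity (fun _ => 1) μ ν ≠ ∞ := ((affinity_one_le μ ν).trans_lt ENNReal.one_lt_top).ne
  have n2 : affinity A (μ.map f) (ν.map f) ≠ ∞ :=
    e2 ▸ ((affinity_one_le _ _).trans_lt ENNReal.one_lt_top).ne
  have n3 : affinity (fun a => A (f a)) μ ν ≠ ∞ :=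
    e1 ▸ ((affinity_one_le _ _).trans_lt ENNReal.one_lt_top).ne
  have h := ENNReal.toReal_mono (ENNReal.add_ne_top.2 ⟨n3, ENNReal.one_ne_top⟩) key
  rw [ENNReal.toReal_add n1 n2, ENNReal.toReal_add n3 ENNReal.one_ne_top, ENNReal.toReal_one] at h
  linarith

lemma sqHellinger_self (P : Measure α) : sqHellinger P P = 0 := by
  simp [sqHellinger]

end Affinity

section BayesNet

variable {n : ℕ} {Ω : Fin n → Type*} [∀ i, MeasurableSpace (Ω i)]

variable [∀ i, StandardBorelSpace (Ω i)] [∀ i, Nonempty (Ω i)]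

lemma IsBayesNet.map_eq_compProd {P : Measure (∀ i, Ω i)} [IsFiniteMeasure P]
    {par : Fin n → Finset (Fin n)} (hP : IsBayesNet P par) (i : Fin n) :
    P.map (fun x => ((proj (par i) x, proj (Finset.Iio i) x), x i))
      = P.map (fun x => (proj (par i) x, proj (Finset.Iio i) x)) ⊗ₘ
        (condDistrib (fun x => x i) (proj (par i)) P).comap Prod.fst measurable_fst := by
  have h := (condIndepFun_iff_condDistrib_prod_ae_eq_prodMkRight (μ := P) (measurable_pi_apply i)
    (measurable_proj (Finset.Iio i)) (measurable_proj (par i))).1 (hP i).symm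
  rw [← compProd_map_condDistrib (measurable_pi_apply i).aemeasurable]
  exact Measure.compProd_congr h

lemma sqHellinger_map_proj_insert_Iio_le {par : Fin n → Finset (Fin n)}
    (hpar : ∀ i, par i ⊆ Finset.Iio i) (P Q : Measure (∀ i, Ω i)) [IsProbabilityMeasure P]
    [IsProbabilityMeasure Q] (hP : IsBayesNet P par) (hQ : IsBayesNet Q par) (i : Fin n) :
    sqHellinger (P.map (proj (insert i (Finset.Iio i)))) (Q.map (proj (insert i (Finset.Iio i))))
      ≤ sqHellinger (P.map (proj (Finset.Iio i))) (Q.map (proj (Finset.Iio i)))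
        + sqHellinger (P.map (proj (insert i (par i)))) (Q.map (proj (insert i (par i)))) := by
  have hY : Measurable fun x : ∀ i, Ω i => (proj (par i) x, proj (Finset.Iio i) x) :=
    (measurable_proj _).prodMk (measurable_proj _)
  have hX : Measurable fun x : ∀ i, Ω i => ((proj (par i) x, proj (Finset.Iio i) x), x i) :=
    hY.prodMk (measurable_pi_apply i)
  have := Measure.isProbabilityMeasure_map (μ := P) hY.aemeasurable
  have := Measure.isProbabilityMeasure_map (μ := Q) hY.aemeasurable
  have hmarginal (T : Measure (∀ i, Ω i)) [IsProbabilityMeasure T] :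
      (T.map fun x => (proj (par i) x, proj (Finset.Iio i) x)).map Prod.fst
        ⊗ₘ condDistrib (fun x => x i) (proj (par i)) T = T.map fun x => (proj (par i) x, x i) := by
    rw [Measure.map_map measurable_fst hY]
    exact compProd_map_condDistrib (measurable_pi_apply i).aemeasurable
  have hjoin : Measurable fun (y : ((∀ j : par i, Ω j) × (∀ j : Finset.Iio i, Ω j)) × Ω i)
      (j : (insert i (Finset.Iio i) : Finset (Fin n))) =>
        if h : (j : Fin n) = i then cast (congrArg Ω h.symm) y.2
          else y.1.2 ⟨j, Finset.mem_of_mem_insert_of_ne j.2 h⟩ := by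
    refine measurable_pi_lambda _ fun ⟨j, hj⟩ => ?_
    by_cases h : j = i
    · subst h
      simpa only [dite_true, cast_eq] using measurable_snd
    · simp only [h, dite_false]
      fun_prop
  have hrestrict : Measurable fun (y : ∀ j : (insert i (par i) : Finset (Fin n)), Ω j) =>
      ((fun j => y ⟨j, Finset.mem_insert_of_mem j.2⟩ : ∀ j : par i, Ω j),
        y ⟨i, Finset.mem_insert_self _ _⟩) := by fun_prop
  have hdup : Measurable fun (y : ∀ j : Finset.Iio i, Ω j) =>
      ((fun j => y ⟨j, hpar i j.2⟩ : ∀ j : par i, Ω j), y) := by fun_prop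
  calc _ ≤ sqHellinger (P.map fun x => ((proj (par i) x, proj (Finset.Iio i) x), x i))
          (Q.map fun x => ((proj (par i) x, proj (Finset.Iio i) x), x i)) := by
        convert sqHellinger_map_comp_le hX hjoin P Q using 3 <;>
        · ext x ⟨j, hj⟩
          by_cases h : j = i
          · subst h
            simp [proj]
          · simp [proj, h]
    _ ≤ sqHellinger (P.map fun x => (proj (par i) x, proj (Finset.Iio i) x))
          (Q.map fun x => (proj (par i) x, proj (Finset.Iio i) x))
        + sqHellinger (P.map fun x => (proj (par i) x, x i))
          (Q.map fun x => (proj (par i) x, x i)) := by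
        rw [hP.map_eq_compProd i, hQ.map_eq_compProd i, ← hmarginal P, ← hmarginal Q]
        exact sqHellinger_compProd_comap_le measurable_fst _ _ _ _
    _ ≤ _ := add_le_add (sqHellinger_map_comp_le (measurable_proj _) hdup P Q)
        (sqHellinger_map_comp_le (measurable_proj _) hrestrict P Q)

end BayesNet

/-- Subadditivity of the squared Hellinger distance on Bayes-nets. -/
theorem sqHellinger_subadditivity_bayes_net
    {n : ℕ} (Ω : Fin n → Type u) [∀ i, MeasurableSpace (Ω i)]
    [∀ i, StandardBorelSpace (Ω i)] [∀ i, Nonempty (Ω i)]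
    (par : Fin n → Finset (Fin n)) (hpar : ∀ i, par i ⊆ Finset.Iio i)
    (P Q : Measure (∀ i, Ω i)) [IsProbabilityMeasure P] [IsProbabilityMeasure Q]
    (hP : IsBayesNet P par) (hQ : IsBayesNet Q par) :
    sqHellinger P Q ≤ ∑ i : Fin n,
      sqHellinger (P.map (proj (insert i (par i)))) (Q.map (proj (insert i (par i)))) := by
  have hprefix (k : ℕ) (hk : k ≤ n) :
      sqHellinger (P.map (proj {i | i.1 < k})) (Q.map (proj {i | i.1 < k}))
        ≤ ∑ i with i.1 < k,
          sqHellinger (P.map (proj (insert i (par i)))) (Q.map (proj (insert i (par i)))) := by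
    induction k with
    | zero =>
      have hempty (T : Measure (∀ i, Ω i)) [IsProbabilityMeasure T] :
          T.map (proj {i | i.1 < 0}) = Measure.dirac fun i => (by simpa using i.2 : False).elim := by
        have : proj (Ω := Ω) {i | i.1 < 0} = fun _ i => (by simpa using i.2 : False).elim := by
          ext x ⟨i, hi⟩
          simp at hi
        rw [this, Measure.map_const, measure_univ, one_smul]
      rw [hempty P, hempty Q, sqHellinger_self]
      simp
    | succ k ih =>
      have hIio : ({i | i.1 < k} : Finset (Fin n)) = Finset.Iio ⟨k, hk⟩ := by
        ext i
        simp [Fin.lt_def]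
      have hsucc : ({i | i.1 < k + 1} : Finset (Fin n))
          = insert ⟨k, hk⟩ (Finset.Iio ⟨k, hk⟩) := by
        ext i
        simp only [Finset.mem_filter, Finset.mem_univ, true_and, Finset.mem_insert,
          Finset.mem_Iio, Fin.lt_def, Fin.ext_iff]
        omega
      have h := ih (Nat.le_of_succ_le hk)
      rw [hIio] at h
      rw [hsucc, Finset.sum_insert (by simp), add_comm]
      exact (sqHellinger_map_proj_insert_Iio_le hpar P Q hP hQ _).trans (by gcongr)
  have hg : Measurable fun (y : ∀ i : ({i | i.1 < n} : Finset (Fin n)), Ω i) (i : Fin n) =>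
      y ⟨i, by simp⟩ := by fun_prop
  have h := sqHellinger_map_comp_le (measurable_proj {i | i.1 < n}) hg P Q
  have hid : (fun (x : ∀ i, Ω i) (i : Fin n) => proj {i | i.1 < n} x ⟨i, by simp⟩) = id := rfl
  rw [hid, Measure.map_id, Measure.map_id] at h
  simpa using h.trans (hprefix n le_rfl)
end
end

section
/- Let P and Q be probability measures on a product Ω₁×Ω₂×Ω₃ of standard Borel spaces, both of which are Markov chains X→Y→Z. Then H²(P,Q) ≤ H²(P_{XY},Q_{XY}) + H²(P_{YZ},Q_{YZ}). -/
open MeasureTheory ProbabilityTheory Filter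
open scoped ENNReal NNReal

noncomputable section

universe u

/-- A finite measure on a product of three standard Borel spaces is a Markov chain
`X → Y → Z` if the third coordinate is conditionally independent of the first coordinate
given the second coordinate. -/
def IsMarkovChain {Ω₁ Ω₂ Ω₃ : Type*} [MeasurableSpace Ω₁] [MeasurableSpace Ω₂]
    [MeasurableSpace Ω₃] [StandardBorelSpace Ω₁] [StandardBorelSpace Ω₂]
    [StandardBorelSpace Ω₃] [Nonempty Ω₁] [Nonempty Ω₂] [Nonempty Ω₃]
    (P : Measure (Ω₁ × Ω₂ × Ω₃)) [IsFiniteMeasure P] : Prop :=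
  CondIndepFun (MeasurableSpace.comap (fun ω : Ω₁ × Ω₂ × Ω₃ => ω.2.1) inferInstance)
    (measurable_snd.fst.comap_le) (fun ω => ω.2.2) (fun ω => ω.1) P

lemma lintegral_sqrt_mul_le_one {α : Type*} [MeasurableSpace α] {m : Measure α}
    {f g : α → ℝ≥0∞} (hf : Measurable f) (hg : Measurable g)
    [IsProbabilityMeasure (m.withDensity f)] [IsProbabilityMeasure (m.withDensity g)] :
    ∫⁻ x, (f x * g x) ^ (1 / 2 : ℝ) ∂m ≤ 1 := by
  have hf1 : ∫⁻ x, f x ∂m = 1 := by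
    rw [← setLIntegral_univ, ← withDensity_apply _ .univ, measure_univ]
  have hg1 : ∫⁻ x, g x ∂m = 1 := by
    rw [← setLIntegral_univ, ← withDensity_apply _ .univ, measure_univ]
  have h := ENNReal.lintegral_mul_norm_pow_le (μ := m) hf.aemeasurable hg.aemeasurable
    (p := 1 / 2) (q := 1 / 2) (by norm_num) (by norm_num) (by norm_num)
  simp only [hf1, hg1, ENNReal.one_rpow, mul_one] at h
  simpa only [ENNReal.mul_rpow_of_nonneg _ _ (by norm_num : (0 : ℝ) ≤ 1 / 2)] using h

lemma sqHellinger_map_equiv {α β : Type*} [MeasurableSpace α] [MeasurableSpace β] (e : α ≃ᵐ β)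
    (P Q : Measure α) [IsFiniteMeasure P] [IsFiniteMeasure Q] :
    sqHellinger (P.map e) (Q.map e) = sqHellinger P Q := by
  unfold sqHellinger
  rw [← Measure.map_add _ _ e.measurable, e.measurableEmbedding.integral_map]
  congr 1
  refine integral_congr_ae ?_
  filter_upwards [e.measurableEmbedding.rnDeriv_map P (P + Q),
    e.measurableEmbedding.rnDeriv_map Q (P + Q)] with x hP hQ
  rw [hP, hQ]

/-- The squared Hellinger distance in terms of densities with respect to any dominating
measure. -/
lemma sqHellinger_withDensity {α : Type*} [MeasurableSpace α] {m : Measure α} [SigmaFinite m]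
    {f g : α → ℝ≥0∞} (hf : Measurable f) (hg : Measurable g)
    [IsProbabilityMeasure (m.withDensity f)] [IsProbabilityMeasure (m.withDensity g)] :
    sqHellinger (m.withDensity f) (m.withDensity g) =
      1 - (∫⁻ x, (f x * g x) ^ (1 / 2 : ℝ) ∂m).toReal := by
  set P := m.withDensity f with hP
  set Q := m.withDensity g with hQ
  have hPQ : P ≪ P + Q := Measure.AbsolutelyContinuous.rfl.add_right _
  have hQP : Q ≪ P + Q := Measure.AbsolutelyContinuous.rfl.add_right' _
  set a := P.rnDeriv (P + Q) with ha
  set b := Q.rnDeriv (P + Q) with hb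
  have ham : Measurable a := Measure.measurable_rnDeriv _ _
  have hbm : Measurable b := Measure.measurable_rnDeriv _ _
  have hsum : P + Q = m.withDensity (f + g) := (withDensity_add_left hf g).symm
  have haf : ∀ᵐ x ∂m, a x * (f + g) x = f x := by
    filter_upwards [Measure.rnDeriv_mul_rnDeriv (κ := m) hPQ,
      Measure.rnDeriv_withDensity m (hf.add hg), Measure.rnDeriv_withDensity m hf] with x h1 h2 h3
    rw [← hsum] at h2
    rwa [Pi.mul_apply, h2, h3] at h1
  have hbg : ∀ᵐ x ∂m, b x * (f + g) x = g x := by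
    filter_upwards [Measure.rnDeriv_mul_rnDeriv (κ := m) hQP,
      Measure.rnDeriv_withDensity m (hf.add hg), Measure.rnDeriv_withDensity m hg] with x h1 h2 h3
    rw [← hsum] at h2
    rwa [Pi.mul_apply, h2, h3] at h1
  have hA : ∫⁻ x, (f x * g x) ^ (1 / 2 : ℝ) ∂m
      = ∫⁻ x, (a x * b x) ^ (1 / 2 : ℝ) ∂(P + Q) := by
    rw [hsum, lintegral_withDensity_eq_lintegral_mul _ (hf.add hg) (by fun_prop)]
    refine lintegral_congr_ae ?_
    filter_upwards [haf, hbg] with x h1 h2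
    rw [← h1, ← h2, mul_mul_mul_comm, ENNReal.mul_rpow_of_nonneg _ _ (by norm_num),
      ENNReal.mul_rpow_of_nonneg ((f + g) x) _ (by norm_num),
      ← ENNReal.rpow_add_of_nonneg _ _ (by norm_num) (by norm_num), Pi.mul_apply]
    norm_num [mul_comm]
  have hA1 : ∫⁻ x, (a x * b x) ^ (1 / 2 : ℝ) ∂(P + Q) ≤ 1 :=
    hA ▸ lintegral_sqrt_mul_le_one hf hg
  have hAm : Measurable fun x ↦ (a x * b x) ^ (1 / 2 : ℝ) := by fun_prop
  have hia : Integrable (fun x ↦ (a x).toReal) (P + Q) := Measure.integrable_toReal_rnDeriv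
  have hib : Integrable (fun x ↦ (b x).toReal) (P + Q) := Measure.integrable_toReal_rnDeriv
  have hA_top := (hA1.trans_lt ENNReal.one_lt_top).ne
  have hiab : Integrable (fun x ↦ ((a x * b x) ^ (1 / 2 : ℝ)).toReal) (P + Q) :=
    integrable_toReal_of_lintegral_ne_top hAm.aemeasurable hA_top
  have hint : ∀ x, (√(a x).toReal - √(b x).toReal) ^ 2
      = (a x).toReal + (b x).toReal - 2 * ((a x * b x) ^ (1 / 2 : ℝ)).toReal := fun x ↦ by
    rw [← ENNReal.toReal_rpow, ENNReal.toReal_mul, ← Real.sqrt_eq_rpow,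
      Real.sqrt_mul ENNReal.toReal_nonneg, sub_sq, Real.sq_sqrt ENNReal.toReal_nonneg,
      Real.sq_sqrt ENNReal.toReal_nonneg]
    ring
  have hia1 : ∫ x, (a x).toReal ∂(P + Q) = 1 := by
    rw [Measure.integral_toReal_rnDeriv hPQ]; simp
  have hib1 : ∫ x, (b x).toReal ∂(P + Q) = 1 := by
    rw [Measure.integral_toReal_rnDeriv hQP]; simp
  rw [sqHellinger, hA]
  simp_rw [← ha, ← hb, hint]
  rw [integral_sub (by exact hia.add hib) (hiab.const_mul 2), integral_add hia hib, hia1, hib1,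
    integral_const_mul, integral_toReal hAm.aemeasurable (ae_lt_top hAm hA_top)]
  ring

lemma withDensity_compProd_eq_withDensity {α β : Type*} [MeasurableSpace α] [MeasurableSpace β]
    {μ : Measure α} [SFinite μ] {p : α → ℝ≥0∞} (hp : Measurable p) [SFinite (μ.withDensity p)]
    {κ κ' : Kernel α β} [IsSFiniteKernel κ] [IsSFiniteKernel κ'] {F : α → β → ℝ≥0∞}
    (hF : Measurable fun x : α × β ↦ F x.1 x.2) (hκ' : ∀ y, κ' y = (κ y).withDensity (F y)) :
    (μ.withDensity p) ⊗ₘ κ' = (μ ⊗ₘ κ).withDensity fun x ↦ p x.1 * F x.1 x.2 := by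
  have hFy : ∀ y, Measurable (F y) := fun y ↦ hF.comp measurable_prodMk_left
  refine Measure.ext_of_lintegral _ fun φ hφ ↦ ?_
  rw [Measure.lintegral_compProd hφ,
    lintegral_withDensity_eq_lintegral_mul _ hp hφ.lintegral_kernel_prod_right',
    lintegral_withDensity_eq_lintegral_mul _ (by fun_prop) hφ,
    Measure.lintegral_compProd (by fun_prop)]
  refine lintegral_congr fun y ↦ ?_
  simp only [Pi.mul_apply, hκ', mul_assoc]
  have hφy : Measurable fun x ↦ φ (y, x) := hφ.comp measurable_prodMk_left
  rw [lintegral_withDensity_eq_lintegral_mul _ (hFy y) hφy,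
    ← lintegral_const_mul _ ((hFy y).mul hφy)]
  rfl

/-- Disintegrated form of the squared Hellinger distance between two measures given by
marginals and conditional kernels. -/
lemma sqHellinger_compProd {α β : Type*} [MeasurableSpace α] [MeasurableSpace β]
    {μ : Measure α} [IsFiniteMeasure μ] {p q : α → ℝ≥0∞} (hp : Measurable p) (hq : Measurable q)
    [IsProbabilityMeasure (μ.withDensity p)] [IsProbabilityMeasure (μ.withDensity q)]
    {κ κP κQ : Kernel α β} [IsFiniteKernel κ] [IsMarkovKernel κP] [IsMarkovKernel κQ]
    {F G : α → β → ℝ≥0∞} (hF : Measurable fun x : α × β ↦ F x.1 x.2)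
    (hG : Measurable fun x : α × β ↦ G x.1 x.2)
    (hκP : ∀ y, κP y = (κ y).withDensity (F y)) (hκQ : ∀ y, κQ y = (κ y).withDensity (G y)) :
    sqHellinger ((μ.withDensity p) ⊗ₘ κP) ((μ.withDensity q) ⊗ₘ κQ) =
      1 - (∫⁻ y, (p y * q y) ^ (1 / 2 : ℝ) *
        ∫⁻ x, (F y x * G y x) ^ (1 / 2 : ℝ) ∂(κ y) ∂μ).toReal := by
  have hP := withDensity_compProd_eq_withDensity (μ := μ) hp hF hκP
  have hQ := withDensity_compProd_eq_withDensity (μ := μ) hq hG hκQ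
  have : IsProbabilityMeasure ((μ ⊗ₘ κ).withDensity fun x ↦ p x.1 * F x.1 x.2) := by
    rw [← hP]; infer_instance
  have : IsProbabilityMeasure ((μ ⊗ₘ κ).withDensity fun x ↦ q x.1 * G x.1 x.2) := by
    rw [← hQ]; infer_instance
  rw [hP, hQ, sqHellinger_withDensity (by fun_prop) (by fun_prop),
    Measure.lintegral_compProd (by fun_prop)]
  congr 3 with y
  have hFy : Measurable (F y) := hF.comp measurable_prodMk_left
  have hGy : Measurable (G y) := hG.comp measurable_prodMk_left
  rw [← lintegral_const_mul _ (by fun_prop)]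
  refine lintegral_congr fun x ↦ ?_
  rw [mul_mul_mul_comm, ENNReal.mul_rpow_of_nonneg _ _ (by norm_num)]

lemma IsMarkovChain.map_eq_compProd {Ω₁ Ω₂ Ω₃ : Type*} [MeasurableSpace Ω₁] [MeasurableSpace Ω₂]
    [MeasurableSpace Ω₃] [StandardBorelSpace Ω₁] [StandardBorelSpace Ω₂]
    [StandardBorelSpace Ω₃] [Nonempty Ω₁] [Nonempty Ω₂] [Nonempty Ω₃]
    {P : Measure (Ω₁ × Ω₂ × Ω₃)} [IsFiniteMeasure P] (hP : IsMarkovChain P) :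
    P.map (fun ω ↦ (ω.2.1, ω.2.2, ω.1)) = (P.map fun ω ↦ ω.2.1) ⊗ₘ
      (condDistrib (fun ω ↦ ω.2.2) (fun ω ↦ ω.2.1) P ×ₖ
        condDistrib (fun ω ↦ ω.1) (fun ω ↦ ω.2.1) P) := by
  rw [Measure.compProd_eq_comp_prod]
  exact (condIndepFun_iff_map_prod_eq_prod_condDistrib_prod_condDistrib (by fun_prop)
    (by fun_prop) (by fun_prop)).1 hP

lemma ENNReal.add_le_mul_add_one {a b : ℝ≥0∞} (ha : a ≤ 1) (hb : b ≤ 1) :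
    a + b ≤ a * b + 1 := by
  lift a to ℝ≥0 using (ha.trans_lt ENNReal.one_lt_top).ne
  lift b to ℝ≥0 using (hb.trans_lt ENNReal.one_lt_top).ne
  norm_cast at *
  rw [← NNReal.coe_le_coe] at *
  push_cast at *
  nlinarith

lemma lintegral_mul_add_le {α : Type*} [MeasurableSpace α] {μ : Measure α} {w A B : α → ℝ≥0∞}
    (hw : Measurable w) (hA : Measurable A) (hw1 : ∫⁻ y, w y ∂μ ≤ 1)
    (hA1 : ∀ y, A y ≤ 1) (hB1 : ∀ y, B y ≤ 1) :
    (∫⁻ y, w y * A y ∂μ).toReal + (∫⁻ y, w y * B y ∂μ).toReal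
      ≤ (∫⁻ y, w y * (A y * B y) ∂μ).toReal + 1 := by
  have hfin : ∀ {C : α → ℝ≥0∞}, (∀ y, C y ≤ 1) → ∫⁻ y, w y * C y ∂μ ≠ ∞ := fun hC ↦
    (((lintegral_mono fun y ↦ mul_le_of_le_one_right' (hC y)).trans hw1).trans_lt
      ENNReal.one_lt_top).ne
  have hAB := hfin fun y ↦ mul_le_one' (hA1 y) (hB1 y)
  rw [← ENNReal.toReal_add (hfin hA1) (hfin hB1), ← ENNReal.toReal_one,
    ← ENNReal.toReal_add hAB ENNReal.one_ne_top]
  refine ENNReal.toReal_mono (ENNReal.add_ne_top.2 ⟨hAB, ENNReal.one_ne_top⟩) ?_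
  calc ∫⁻ y, w y * A y ∂μ + ∫⁻ y, w y * B y ∂μ
      = ∫⁻ y, w y * (A y + B y) ∂μ := by
        rw [← lintegral_add_left (by fun_prop)]; simp_rw [mul_add]
    _ ≤ ∫⁻ y, w y * (A y * B y + 1) ∂μ := by
        exact lintegral_mono fun y ↦ mul_le_mul_right (ENNReal.add_le_mul_add_one (hA1 y) (hB1 y)) _
    _ = ∫⁻ y, w y * (A y * B y) ∂μ + ∫⁻ y, w y ∂μ := by
        rw [← lintegral_add_right _ hw]; simp_rw [mul_add, mul_one]
    _ ≤ _ := by gcongr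

lemma Kernel.exists_density_of_absolutelyContinuous {α β : Type*} [MeasurableSpace α]
    [MeasurableSpace β] [MeasurableSpace.CountableOrCountablyGenerated α β]
    (κ η : Kernel α β) [IsFiniteKernel κ] [IsFiniteKernel η] (h : ∀ y, κ y ≪ η y) :
    ∃ F : α → β → ℝ≥0∞, Measurable (fun x : α × β ↦ F x.1 x.2) ∧
      ∀ y, κ y = (η y).withDensity (F y) :=
  ⟨κ.rnDeriv η, κ.measurable_rnDeriv η, fun y ↦ by
    rw [← Kernel.withDensity_apply _ (κ.measurable_rnDeriv η), Kernel.withDensity_rnDeriv_eq (h y)]⟩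

/-- Subadditivity of the squared Hellinger distance for mixtures of product kernels. -/
lemma sqHellinger_compProd_prod_le {α β γ : Type*} [MeasurableSpace α] [MeasurableSpace β]
    [MeasurableSpace γ] [MeasurableSpace.CountableOrCountablyGenerated α β]
    [MeasurableSpace.CountableOrCountablyGenerated α γ]
    (μ ν : Measure α) [IsProbabilityMeasure μ] [IsProbabilityMeasure ν]
    (κP κQ : Kernel α β) [IsMarkovKernel κP] [IsMarkovKernel κQ]
    (ηP ηQ : Kernel α γ) [IsMarkovKernel ηP] [IsMarkovKernel ηQ] :
    sqHellinger (μ ⊗ₘ (κP ×ₖ ηP)) (ν ⊗ₘ (κQ ×ₖ ηQ)) ≤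
      sqHellinger (μ ⊗ₘ κP) (ν ⊗ₘ κQ) + sqHellinger (μ ⊗ₘ ηP) (ν ⊗ₘ ηQ) := by
  obtain ⟨F, hF, hκP⟩ := Kernel.exists_density_of_absolutelyContinuous κP (κP + κQ)
    fun _ ↦ Measure.AbsolutelyContinuous.rfl.add_right _
  obtain ⟨G, hG, hκQ⟩ := Kernel.exists_density_of_absolutelyContinuous κQ (κP + κQ)
    fun _ ↦ Measure.AbsolutelyContinuous.rfl.add_right' _
  obtain ⟨F', hF', hηP⟩ := Kernel.exists_density_of_absolutelyContinuous ηP (ηP + ηQ)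
    fun _ ↦ Measure.AbsolutelyContinuous.rfl.add_right _
  obtain ⟨G', hG', hηQ⟩ := Kernel.exists_density_of_absolutelyContinuous ηQ (ηP + ηQ)
    fun _ ↦ Measure.AbsolutelyContinuous.rfl.add_right' _
  obtain ⟨p, hp, hμ⟩ : ∃ p, Measurable p ∧ μ = (μ + ν).withDensity p :=
    ⟨_, Measure.measurable_rnDeriv _ _, (Measure.withDensity_rnDeriv_eq μ (μ + ν)
      (Measure.AbsolutelyContinuous.rfl.add_right _)).symm⟩
  obtain ⟨q, hq, hν⟩ : ∃ q, Measurable q ∧ ν = (μ + ν).withDensity q :=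
    ⟨_, Measure.measurable_rnDeriv _ _, (Measure.withDensity_rnDeriv_eq ν (μ + ν)
      (Measure.AbsolutelyContinuous.rfl.add_right' _)).symm⟩
  generalize hm : μ + ν = m at hμ hν
  have : IsFiniteMeasure m := hm ▸ inferInstance
  generalize hκ : κP + κQ = κ at hκP hκQ
  have : IsFiniteKernel κ := hκ ▸ inferInstance
  generalize hη : ηP + ηQ = η at hηP hηQ
  have : IsFiniteKernel η := hη ▸ inferInstance
  clear hm
  subst hμ hν
  have hFy : ∀ y, Measurable (F y) := fun y ↦ hF.comp measurable_prodMk_left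
  have hGy : ∀ y, Measurable (G y) := fun y ↦ hG.comp measurable_prodMk_left
  have hFy' : ∀ y, Measurable (F' y) := fun y ↦ hF'.comp measurable_prodMk_left
  have hGy' : ∀ y, Measurable (G' y) := fun y ↦ hG'.comp measurable_prodMk_left
  rw [sqHellinger_compProd hp hq hF hG hκP hκQ, sqHellinger_compProd hp hq hF' hG' hηP hηQ,
    sqHellinger_compProd (κ := κ ×ₖ η) (F := fun y x ↦ F y x.1 * F' y x.2)
      (G := fun y x ↦ G y x.1 * G' y x.2) hp hq]
  rotate_left
  · exact (hF.comp (measurable_fst.prodMk measurable_snd.fst)).mul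
      (hF'.comp (measurable_fst.prodMk measurable_snd.snd))
  · exact (hG.comp (measurable_fst.prodMk measurable_snd.fst)).mul
      (hG'.comp (measurable_fst.prodMk measurable_snd.snd))
  · intro y
    have := hκP y ▸ (inferInstance : SFinite (κP y))
    have := hηP y ▸ (inferInstance : SFinite (ηP y))
    rw [Kernel.prod_apply, Kernel.prod_apply, hκP, hηP, prod_withDensity (hFy y) (hFy' y)]
  · intro y
    have := hκQ y ▸ (inferInstance : SFinite (κQ y))
    have := hηQ y ▸ (inferInstance : SFinite (ηQ y))
    rw [Kernel.prod_apply, Kernel.prod_apply, hκQ, hηQ, prod_withDensity (hGy y) (hGy' y)]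
  have hprod : ∀ y, ∫⁻ x, (F y x.1 * F' y x.2 * (G y x.1 * G' y x.2)) ^ (1 / 2 : ℝ) ∂((κ ×ₖ η) y)
      = (∫⁻ x, (F y x * G y x) ^ (1 / 2 : ℝ) ∂(κ y))
        * ∫⁻ x, (F' y x * G' y x) ^ (1 / 2 : ℝ) ∂(η y) := fun y ↦ by
    rw [Kernel.prod_apply, ← lintegral_prod_mul (by fun_prop) (by fun_prop)]
    refine lintegral_congr fun x ↦ ?_
    rw [mul_mul_mul_comm, ENNReal.mul_rpow_of_nonneg _ _ (by norm_num)]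
  simp_rw [hprod]
  have hA1 : ∀ y, ∫⁻ x, (F y x * G y x) ^ (1 / 2 : ℝ) ∂(κ y) ≤ 1 := fun y ↦ by
    have : IsProbabilityMeasure ((κ y).withDensity (F y)) := hκP y ▸ inferInstance
    have : IsProbabilityMeasure ((κ y).withDensity (G y)) := hκQ y ▸ inferInstance
    exact lintegral_sqrt_mul_le_one (hFy y) (hGy y)
  have hB1 : ∀ y, ∫⁻ x, (F' y x * G' y x) ^ (1 / 2 : ℝ) ∂(η y) ≤ 1 := fun y ↦ by
    have : IsProbabilityMeasure ((η y).withDensity (F' y)) := hηP y ▸ inferInstance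
    have : IsProbabilityMeasure ((η y).withDensity (G' y)) := hηQ y ▸ inferInstance
    exact lintegral_sqrt_mul_le_one (hFy' y) (hGy' y)
  have h := lintegral_mul_add_le (μ := m) (w := fun y ↦ (p y * q y) ^ (1 / 2 : ℝ)) (by fun_prop)
    (((hF.mul hG).pow_const (1 / 2 : ℝ)).lintegral_kernel_prod_right' (κ := κ))
    (lintegral_sqrt_mul_le_one hp hq) hA1 hB1
  simp only [Pi.mul_apply] at h
  linarith

/-- Subadditivity of the squared Hellinger distance on three-variable Markov chains. -/
theorem sqHellinger_subadditivity_markov_chain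
    (Ω₁ Ω₂ Ω₃ : Type u) [MeasurableSpace Ω₁] [MeasurableSpace Ω₂] [MeasurableSpace Ω₃]
    [StandardBorelSpace Ω₁] [StandardBorelSpace Ω₂] [StandardBorelSpace Ω₃]
    [Nonempty Ω₁] [Nonempty Ω₂] [Nonempty Ω₃]
    (P Q : Measure (Ω₁ × Ω₂ × Ω₃)) [IsProbabilityMeasure P] [IsProbabilityMeasure Q]
    (hP : IsMarkovChain P) (hQ : IsMarkovChain Q) :
    sqHellinger P Q ≤
      sqHellinger (P.map fun ω => (ω.1, ω.2.1)) (Q.map fun ω => (ω.1, ω.2.1))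
        + sqHellinger (P.map fun ω => ω.2) (Q.map fun ω => ω.2) := by
  have : IsProbabilityMeasure (P.map fun ω ↦ ω.2.1) :=
    Measure.isProbabilityMeasure_map (by fun_prop)
  have : IsProbabilityMeasure (Q.map fun ω ↦ ω.2.1) :=
    Measure.isProbabilityMeasure_map (by fun_prop)
  let e : Ω₁ × Ω₂ × Ω₃ ≃ᵐ Ω₂ × Ω₃ × Ω₁ := MeasurableEquiv.prodComm.trans MeasurableEquiv.prodAssoc
  have he : ⇑e = fun ω ↦ (ω.2.1, ω.2.2, ω.1) := rfl
  have hs : ⇑(MeasurableEquiv.prodComm : Ω₁ × Ω₂ ≃ᵐ Ω₂ × Ω₁) = Prod.swap := rfl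
  have hswap (R : Measure (Ω₁ × Ω₂ × Ω₃)) [IsProbabilityMeasure R] :
      (R.map fun ω ↦ (ω.1, ω.2.1)).map (MeasurableEquiv.prodComm : Ω₁ × Ω₂ ≃ᵐ Ω₂ × Ω₁) =
        (R.map fun ω ↦ ω.2.1) ⊗ₘ condDistrib (fun ω ↦ ω.1) (fun ω ↦ ω.2.1) R := by
    rw [compProd_map_condDistrib (by fun_prop), hs, Measure.map_map (by fun_prop) (by fun_prop)]
    rfl
  have hsnd (R : Measure (Ω₁ × Ω₂ × Ω₃)) [IsProbabilityMeasure R] :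
      (R.map fun ω ↦ ω.2) =
        (R.map fun ω ↦ ω.2.1) ⊗ₘ condDistrib (fun ω ↦ ω.2.2) (fun ω ↦ ω.2.1) R := by
    rw [compProd_map_condDistrib (by fun_prop)]
  have h₁ : IsProbabilityMeasure (P.map fun ω ↦ (ω.1, ω.2.1)) :=
    Measure.isProbabilityMeasure_map (by fun_prop)
  have h₂ : IsProbabilityMeasure (Q.map fun ω ↦ (ω.1, ω.2.1)) :=
    Measure.isProbabilityMeasure_map (by fun_prop)
  rw [← sqHellinger_map_equiv e P Q, he, hP.map_eq_compProd, hQ.map_eq_compProd,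
    ← sqHellinger_map_equiv MeasurableEquiv.prodComm (P.map fun ω ↦ (ω.1, ω.2.1)), hswap, hswap,
    hsnd P, hsnd Q, add_comm]
  exact sqHellinger_compProd_prod_le _ _ _ _ _ _
end
end

section
/- Let P and Q be probability measures on Ω₁×⋯×Ω_n (standard Borel spaces) that are both Bayes-nets with respect to a common DAG G with topological ordering (1,…,n) and parent sets Π_i ⊆ {1,…,i−1}. Then the Kullback–Leibler divergence satisfies KL(P,Q) ≤ Σ_{i=1}^n KL(P_{X_i∪X_{Π_i}}, Q_{X_i∪X_{Π_i}}). -/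
open MeasureTheory ProbabilityTheory Filter
open scoped ENNReal NNReal

noncomputable section

universe u

open scoped Classical in
/-- The Kullback-Leibler divergence `KL(P,Q) = ∫ log (dP/dQ) dP` when `P ≪ Q` (and the
integral exists), and `+∞` otherwise. -/
def klDiv {Ω : Type*} [MeasurableSpace Ω] (P Q : Measure Ω) : ℝ≥0∞ :=
  if P ≪ Q ∧ Integrable (fun x => Real.log ((P.rnDeriv Q x).toReal)) P
  then ENNReal.ofReal (∫ x, Real.log ((P.rnDeriv Q x).toReal) ∂P)
  else ⊤

lemma klDiv_eq_informationTheory_klDiv {α : Type*} [MeasurableSpace α] (μ ν : Measure α)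
    [IsProbabilityMeasure μ] [IsProbabilityMeasure ν] :
    klDiv μ ν = InformationTheory.klDiv μ ν := by
  rw [klDiv, InformationTheory.klDiv_def]
  simp only [probReal_univ, add_sub_cancel_right]
  rfl

lemma compProd_prodMkRight_map_swap {α β γ : Type*} {mα : MeasurableSpace α}
    {mβ : MeasurableSpace β} {mγ : MeasurableSpace γ} (μ : Measure α) [SFinite μ]
    (κ : Kernel α β) [IsSFiniteKernel κ] (η : Kernel α γ) [IsSFiniteKernel η] :
    ((μ ⊗ₘ κ) ⊗ₘ η.prodMkRight β).map (fun p ↦ ((p.1.1, p.2), p.1.2)) =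
      (μ ⊗ₘ η) ⊗ₘ κ.prodMkRight γ := by
  refine Measure.ext_of_lintegral _ fun f hf ↦ ?_
  have hf' : Measurable fun p : (α × β) × γ ↦ f ((p.1.1, p.2), p.1.2) := by fun_prop
  rw [lintegral_map hf (by fun_prop), Measure.lintegral_compProd hf',
    Measure.lintegral_compProd hf'.lintegral_kernel_prod_right',
    Measure.lintegral_compProd hf,
    Measure.lintegral_compProd (Measurable.lintegral_kernel_prod_right' hf)]
  refine lintegral_congr fun a ↦ ?_
  simp only [Kernel.prodMkRight_apply]
  exact lintegral_lintegral_swap (by fun_prop)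

/-- Changing the conditioning from `α × β` to `α` does not increase the divergence of two kernels
that only depend on `α`. -/
lemma klDiv_compProd_prodMkRight_le {α β γ : Type*} {mα : MeasurableSpace α}
    {mβ : MeasurableSpace β} {mγ : MeasurableSpace γ} (μ : Measure α) [IsFiniteMeasure μ]
    (θ : Kernel α β) [IsMarkovKernel θ] (κ η : Kernel α γ) [IsMarkovKernel κ]
    [IsMarkovKernel η] :
    InformationTheory.klDiv ((μ ⊗ₘ θ) ⊗ₘ κ.prodMkRight β) ((μ ⊗ₘ θ) ⊗ₘ η.prodMkRight β) ≤
      InformationTheory.klDiv (μ ⊗ₘ κ) (μ ⊗ₘ η) := by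
  rw [← compProd_prodMkRight_map_swap μ κ θ, ← compProd_prodMkRight_map_swap μ η θ,
    ← InformationTheory.klDiv_compProd_left (μ ⊗ₘ κ) (μ ⊗ₘ η) (θ.prodMkRight γ)]
  exact InformationTheory.klDiv_map_le _ _ (by fun_prop)

lemma map_prod_eq_compProd_of_condIndepFun {A α β γ : Type*} {mA : MeasurableSpace A}
    [StandardBorelSpace A] {mα : MeasurableSpace α} {mβ : MeasurableSpace β}
    {mγ : MeasurableSpace γ} [StandardBorelSpace β] [Nonempty β] [StandardBorelSpace γ]
    [Nonempty γ] {P : Measure A} [IsFiniteMeasure P] {k : A → α} {g : A → β} {f : A → γ}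
    (hk : Measurable k) (hg : Measurable g) (hf : Measurable f)
    (h : CondIndepFun (MeasurableSpace.comap k mα) hk.comap_le f g P) :
    P.map (fun ω ↦ ((k ω, g ω), f ω)) =
      P.map (fun ω ↦ (k ω, g ω)) ⊗ₘ (condDistrib f k P).prodMkRight β := by
  rw [← condDistrib_ae_eq_iff_measure_eq_compProd (μ := P) _ hf.aemeasurable]
  exact (condIndepFun_iff_condDistrib_prod_ae_eq_prodMkRight hf hg hk).1 h.symm

/-- If `f` and `g` are conditionally independent given `k` under both measures, then the
divergence of the joint laws of `(k, g, f)` is at most that of `(k, g)` plus that of `(k, f)`. -/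
lemma klDiv_map_prod_le_of_condIndepFun {A α β γ : Type*} {mA : MeasurableSpace A}
    [StandardBorelSpace A] {mα : MeasurableSpace α} {mβ : MeasurableSpace β}
    {mγ : MeasurableSpace γ} [StandardBorelSpace β] [Nonempty β] [StandardBorelSpace γ]
    [Nonempty γ] {P Q : Measure A} [IsFiniteMeasure P] [IsFiniteMeasure Q]
    {k : A → α} {g : A → β} {f : A → γ}
    (hk : Measurable k) (hg : Measurable g) (hf : Measurable f)
    (hP : CondIndepFun (MeasurableSpace.comap k mα) hk.comap_le f g P)
    (hQ : CondIndepFun (MeasurableSpace.comap k mα) hk.comap_le f g Q) :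
    InformationTheory.klDiv (P.map (fun ω ↦ ((k ω, g ω), f ω)))
        (Q.map (fun ω ↦ ((k ω, g ω), f ω))) ≤
      InformationTheory.klDiv (P.map (fun ω ↦ (k ω, g ω))) (Q.map (fun ω ↦ (k ω, g ω))) +
        InformationTheory.klDiv (P.map (fun ω ↦ (k ω, f ω))) (Q.map (fun ω ↦ (k ω, f ω))) := by
  rw [map_prod_eq_compProd_of_condIndepFun hk hg hf hP,
    map_prod_eq_compProd_of_condIndepFun hk hg hf hQ, InformationTheory.klDiv_compProd_eq_add]
  gcongr
  rw [← compProd_map_condDistrib (μ := P) (X := k) hg.aemeasurable]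
  refine (klDiv_compProd_prodMkRight_le _ _ _ _).trans ?_
  rw [← compProd_map_condDistrib (μ := P) (X := k) hf.aemeasurable,
    ← compProd_map_condDistrib (μ := Q) (X := k) hf.aemeasurable,
    InformationTheory.klDiv_compProd_eq_add (P.map k) (Q.map k)]
  exact le_add_self

/-- Data processing for the laws of two maps, one of which factors through the other. -/
lemma klDiv_map_le_klDiv_map {A α β : Type*} {mA : MeasurableSpace A}
    {mα : MeasurableSpace α} {mβ : MeasurableSpace β} (P Q : Measure A) [IsFiniteMeasure P]
    [IsFiniteMeasure Q] {f : A → α} {g : A → β} {φ : α → β} (hf : Measurable f)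
    (hφ : Measurable φ) (h : ∀ ω, g ω = φ (f ω)) :
    InformationTheory.klDiv (P.map g) (Q.map g) ≤
      InformationTheory.klDiv (P.map f) (Q.map f) := by
  obtain rfl : g = φ ∘ f := funext h
  rw [← Measure.map_map hφ hf, ← Measure.map_map hφ hf]
  exact InformationTheory.klDiv_map_le _ _ hφ

/-- A Bayes-net step: adjoining the coordinate `i` to the previous ones increases the divergence
by at most the divergence of the laws of `i` together with its parents. -/
lemma klDiv_map_proj_insert_Iio_le {n : ℕ} {Ω : Fin n → Type*} [∀ i, MeasurableSpace (Ω i)]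
    [∀ i, StandardBorelSpace (Ω i)] [∀ i, Nonempty (Ω i)]
    {par : Fin n → Finset (Fin n)} {i : Fin n} (hpar : par i ⊆ Finset.Iio i)
    {P Q : Measure (∀ i, Ω i)} [IsFiniteMeasure P] [IsFiniteMeasure Q]
    (hP : IsBayesNet P par) (hQ : IsBayesNet Q par) :
    InformationTheory.klDiv (P.map (proj (insert i (Finset.Iio i))))
        (Q.map (proj (insert i (Finset.Iio i)))) ≤
      InformationTheory.klDiv (P.map (proj (Finset.Iio i))) (Q.map (proj (Finset.Iio i))) +
        InformationTheory.klDiv (P.map (proj (insert i (par i))))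
          (Q.map (proj (insert i (par i)))) := by
  have hg : Measurable (proj (Ω := Ω) (Finset.Iio i)) := measurable_proj _
  have hk : Measurable (proj (Ω := Ω) (par i)) := measurable_proj _
  have hf : Measurable fun x : ∀ i, Ω i ↦ x i := measurable_pi_apply i
  let φ (p : ((∀ j : par i, Ω j) × (∀ j : Finset.Iio i, Ω j)) × Ω i)
      (j : (insert i (Finset.Iio i) : Finset (Fin n))) : Ω j :=
    if h : i = j then h ▸ p.2 else p.1.2 ⟨j, Finset.mem_of_mem_insert_of_ne j.2 (Ne.symm h)⟩
  have hφ : Measurable φ := by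
    refine measurable_pi_lambda _ fun ⟨j, hj⟩ ↦ ?_
    by_cases h : i = j
    · subst h
      simpa [φ] using measurable_snd
    · simp only [φ, h, dite_false]
      fun_prop
  refine (klDiv_map_le_klDiv_map P Q (φ := φ) ((hk.prodMk hg).prodMk hf) hφ fun x ↦ ?_).trans
    ((klDiv_map_prod_le_of_condIndepFun hk hg hf (hP i) (hQ i)).trans (add_le_add ?_ ?_))
  · ext ⟨j, hj⟩
    by_cases h : i = j
    · subst h
      simp [φ, proj]
    · simp [φ, proj, h]
  · exact klDiv_map_le_klDiv_map P Q (φ := fun x ↦ ((fun j ↦ x ⟨j, hpar j.2⟩), x)) hg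
      (by fun_prop) fun _ ↦ rfl
  · exact klDiv_map_le_klDiv_map P Q
      (φ := fun x ↦ ((fun j ↦ x ⟨j, Finset.mem_insert_of_mem j.2⟩),
        x ⟨i, Finset.mem_insert_self _ _⟩))
      (measurable_proj (insert i (par i))) (by fun_prop) fun _ ↦ rfl

lemma klDiv_map_proj_initial_le {n : ℕ} {Ω : Fin n → Type*} [∀ i, MeasurableSpace (Ω i)]
    [∀ i, StandardBorelSpace (Ω i)] [∀ i, Nonempty (Ω i)]
    {par : Fin n → Finset (Fin n)} (hpar : ∀ i, par i ⊆ Finset.Iio i)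
    {P Q : Measure (∀ i, Ω i)} [IsProbabilityMeasure P] [IsProbabilityMeasure Q]
    (hP : IsBayesNet P par) (hQ : IsBayesNet Q par) (m : ℕ) :
    InformationTheory.klDiv (P.map (proj {j | j.val < m})) (Q.map (proj {j | j.val < m})) ≤
      ∑ i with i.val < m, InformationTheory.klDiv (P.map (proj (insert i (par i))))
        (Q.map (proj (insert i (par i)))) := by
  induction m with
  | zero =>
    have h : (Finset.univ.filter fun j : Fin n ↦ j.val < 0) = ∅ := by simp
    have hPQ : P.map (proj ∅) = Q.map (proj ∅) := by
      ext s -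
      rcases s.eq_empty_or_nonempty with rfl | hs
      · simp
      · have := Measure.isProbabilityMeasure_map (μ := P) (measurable_proj ∅).aemeasurable
        have := Measure.isProbabilityMeasure_map (μ := Q) (measurable_proj ∅).aemeasurable
        rw [Subsingleton.eq_univ_of_nonempty hs, measure_univ, measure_univ]
    rw [h, hPQ, InformationTheory.klDiv_self]
    exact zero_le
  | succ m ih =>
    by_cases hm : m < n
    · have h : (Finset.univ.filter fun j : Fin n ↦ j.val < m + 1) =
          insert ⟨m, hm⟩ (Finset.Iio ⟨m, hm⟩) := by
        ext j
        simp only [Finset.mem_filter_univ, Finset.mem_insert, Finset.mem_Iio, Fin.ext_iff,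
          Fin.lt_def]
        lia
      have h' : (Finset.univ.filter fun j : Fin n ↦ j.val < m) = Finset.Iio ⟨m, hm⟩ := by
        ext j
        simp [Fin.lt_def]
      rw [h'] at ih
      rw [h, Finset.sum_insert (by simp), add_comm]
      exact (klDiv_map_proj_insert_Iio_le (hpar _) hP hQ).trans (by gcongr)
    · have h : (Finset.univ.filter fun j : Fin n ↦ j.val < m + 1) =
          Finset.univ.filter fun j : Fin n ↦ j.val < m := by
        ext j
        simp only [Finset.mem_filter_univ]
        lia
      rwa [h]

/-- Subadditivity of the Kullback-Leibler divergence on Bayes-nets. -/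
theorem klDiv_subadditivity_bayes_net
    {n : ℕ} (Ω : Fin n → Type u) [∀ i, MeasurableSpace (Ω i)]
    [∀ i, StandardBorelSpace (Ω i)] [∀ i, Nonempty (Ω i)]
    (par : Fin n → Finset (Fin n)) (hpar : ∀ i, par i ⊆ Finset.Iio i)
    (P Q : Measure (∀ i, Ω i)) [IsProbabilityMeasure P] [IsProbabilityMeasure Q]
    (hP : IsBayesNet P par) (hQ : IsBayesNet Q par) :
    klDiv P Q ≤ ∑ i : Fin n,
      klDiv (P.map (proj (insert i (par i)))) (Q.map (proj (insert i (par i)))) := by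
  have hprob (μ : Measure (∀ i, Ω i)) [IsProbabilityMeasure μ] (S : Finset (Fin n)) :
      IsProbabilityMeasure (μ.map (proj S)) :=
    Measure.isProbabilityMeasure_map (measurable_proj S).aemeasurable
  simp only [klDiv_eq_informationTheory_klDiv]
  have h := klDiv_map_proj_initial_le hpar hP hQ n
  have huniv : (Finset.univ.filter fun j : Fin n ↦ j.val < n) = Finset.univ := by simp
  rw [huniv] at h
  refine le_trans ?_ h
  simpa using klDiv_map_le_klDiv_map P Q (g := id)
    (φ := fun x i ↦ x ⟨i, Finset.mem_univ i⟩) (measurable_proj Finset.univ)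
    (by fun_prop) fun _ ↦ rfl
end
end

section
/- For every real t ≥ 0 it holds that (ln 2)·(1/2)(√t − 1)² ≤ (t/2)·ln(2t/(t+1)) + (1/2)·ln(2/(t+1)) ≤ (1/2)(√t − 1)², where at t = 0 the middle expression is interpreted as its limit (1/2)·ln 2. Moreover, for t ≠ 1 the quotient ξ(t) = [(t/2)ln(2t/(t+1)) + (1/2)ln(2/(t+1))] / [(1/2)(√t−1)²] is strictly increasing on [0,1), strictly decreasing on (1,∞), and satisfies lim_{t↓0} ξ(t) = ln 2, lim_{t→1} ξ(t) = 1, and lim_{t→∞} ξ(t) = ln 2. -/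
open MeasureTheory ProbabilityTheory Filter
open scoped ENNReal NNReal

noncomputable section

universe u

/-- The generator of the Jensen-Shannon divergence (with natural logarithm).
Note that with Lean's convention `Real.log 0 = 0`, at `t = 0` this formula evaluates to
`(1/2) * Real.log 2`, which is exactly the limit `lim_{t ↓ 0} fJS t`. -/
def fJS (t : ℝ) : ℝ := (t/2) * Real.log (2*t/(t+1)) + (1/2) * Real.log (2/(t+1))

/-- The generator of the squared Hellinger distance. -/
def fH2 (t : ℝ) : ℝ := (1/2) * (Real.sqrt t - 1) ^ 2

/-- The quotient `ξ(t) = fJS t / fH2 t` of the two generators. -/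
def xiJS (t : ℝ) : ℝ := fJS t / fH2 t

/-- Monotone form of l'Hôpital's rule: if `f` and `g` vanish at `0`, `g' > 0` and `f' / g'` is
strictly decreasing on `(0, ∞)`, then so is `f / g`. -/
theorem strictAntiOn_div_of_deriv_div {f g f' g' : ℝ → ℝ} (hf0 : f 0 = 0) (hg0 : g 0 = 0)
    (hf : ∀ x, HasDerivAt f (f' x) x) (hg : ∀ x, HasDerivAt g (g' x) x)
    (hg' : ∀ x, 0 < x → 0 < g' x)
    (hr : StrictAntiOn (fun x => f' x / g' x) (Set.Ioi 0)) :
    StrictAntiOn (fun x => f x / g x) (Set.Ioi 0) := by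
  have hfc : Continuous f := continuous_iff_continuousAt.2 fun x => (hf x).continuousAt
  have hgc : Continuous g := continuous_iff_continuousAt.2 fun x => (hg x).continuousAt
  have mono : StrictMonoOn g (Set.Ici 0) :=
    strictMonoOn_of_hasDerivWithinAt_pos (convex_Ici 0) hgc.continuousOn
      (fun x _ => (hg x).hasDerivWithinAt) (fun x hx => hg' x (by simpa using hx))
  have key : ∀ a b, 0 ≤ a → a < b →
      ∃ c ∈ Set.Ioo a b, f b - f a = f' c / g' c * (g b - g a) := by
    intro a b ha hab
    obtain ⟨c, hc, h⟩ := exists_ratio_hasDerivAt_eq_ratio_slope f f' hab hfc.continuousOn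
      (fun x _ => hf x) g g' hgc.continuousOn (fun x _ => hg x)
    have := hg' c (ha.trans_lt hc.1)
    refine ⟨c, hc, ?_⟩
    field_simp
    linarith
  intro x hx y hy hxy
  have hx' : (0 : ℝ) < x := hx
  obtain ⟨c, hc, h1⟩ := key 0 x le_rfl hx
  obtain ⟨d, hd, h2⟩ := key x y hx'.le hxy
  have hgx : 0 < g x := hg0 ▸ mono (Set.mem_Ici.2 le_rfl) hx'.le hx'
  have hgxy : g x < g y := mono hx'.le (hx'.trans hxy).le hxy
  have hcd : f' d / g' d < f' c / g' c :=
    hr hc.1 (hx'.trans hd.1) (hc.2.trans hd.1)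
  rw [hf0, hg0, sub_zero, sub_zero] at h1
  have h3 : f x / g x = f' c / g' c := by rw [h1]; field_simp
  change f y / g y < f x / g x
  rw [h3, div_lt_iff₀ (hgx.trans hgxy)]
  nlinarith [mul_lt_mul_of_pos_right hcd (sub_pos.2 hgxy)]

theorem strictAntiOn_div_sinh : StrictAntiOn (fun x => x / Real.sinh x) (Set.Ioi 0) := by
  refine strictAntiOn_div_of_deriv_div (f := fun x => x) (f' := fun _ => 1) rfl Real.sinh_zero
    (fun x => hasDerivAt_id x) Real.hasDerivAt_sinh (fun x _ => Real.cosh_pos x) ?_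
  intro x hx y hy hxy
  exact one_div_lt_one_div_of_lt (Real.cosh_pos x)
    (Real.cosh_strictMonoOn (Set.Ioi_subset_Ici_self hx) (Set.Ioi_subset_Ici_self hy) hxy)

theorem tendsto_div_sinh :
    Tendsto (fun x => x / Real.sinh x) (nhdsWithin 0 {(0 : ℝ)}ᶜ) (nhds 1) := by
  have h := (Real.hasDerivAt_sinh 0).tendsto_slope
  simpa [slope_def_field, Function.comp_def] using h.inv₀ (by simp)

/-- The function `fJS t / ((t + 1) / 2)` in the coordinate `t = exp (-2 x)`. -/
def hypJS (x : ℝ) : ℝ := x * (Real.sinh x / Real.cosh x) - Real.log (Real.cosh x)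

/-- The function `fH2 t / ((t + 1) / 2)` in the coordinate `t = exp (-2 x)`. -/
def hypH2 (x : ℝ) : ℝ := 1 - 1 / Real.cosh x

theorem hasDerivAt_hypJS (x : ℝ) : HasDerivAt hypJS (x / Real.cosh x ^ 2) x := by
  have hc := (Real.cosh_pos x).ne'
  have h := ((hasDerivAt_id x).mul ((Real.hasDerivAt_sinh x).div (Real.hasDerivAt_cosh x) hc)).sub
    ((Real.hasDerivAt_cosh x).log hc)
  refine h.congr_deriv ?_
  have := Real.cosh_sq x
  simp only [id, Pi.div_apply]
  field_simp
  linear_combination x * this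

theorem hasDerivAt_hypH2 (x : ℝ) : HasDerivAt hypH2 (Real.sinh x / Real.cosh x ^ 2) x := by
  have hc := (Real.cosh_pos x).ne'
  have h := ((hasDerivAt_const x (1 : ℝ)).div (Real.hasDerivAt_cosh x) hc).const_sub 1
  refine h.congr_deriv ?_
  ring

theorem hypJS_zero : hypJS 0 = 0 := by simp [hypJS]

theorem hypH2_zero : hypH2 0 = 0 := by simp [hypH2]

theorem deriv_hypJS_div_deriv_hypH2 (x : ℝ) :
    x / Real.cosh x ^ 2 / (Real.sinh x / Real.cosh x ^ 2) = x / Real.sinh x :=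
  div_div_div_cancel_right₀ (pow_pos (Real.cosh_pos x) 2).ne' _ _

theorem strictAntiOn_hypJS_div_hypH2 :
    StrictAntiOn (fun x => hypJS x / hypH2 x) (Set.Ioi 0) := by
  refine strictAntiOn_div_of_deriv_div hypJS_zero hypH2_zero hasDerivAt_hypJS hasDerivAt_hypH2
    (fun x hx => div_pos (Real.sinh_pos_iff.2 hx) (pow_pos (Real.cosh_pos x) 2)) ?_
  simpa only [deriv_hypJS_div_deriv_hypH2] using strictAntiOn_div_sinh

theorem tendsto_hypJS_div_hypH2 :
    Tendsto (fun x => hypJS x / hypH2 x) (nhdsWithin 0 {(0 : ℝ)}ᶜ) (nhds 1) := by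
  refine HasDerivAt.lhopital_zero_nhdsNE (Eventually.of_forall hasDerivAt_hypJS)
    (Eventually.of_forall hasDerivAt_hypH2) ?_ ?_ ?_ ?_
  · filter_upwards [self_mem_nhdsWithin] with x hx
    exact div_ne_zero (Real.sinh_ne_zero.2 hx) (pow_pos (Real.cosh_pos x) 2).ne'
  · simpa only [hypJS_zero] using (hasDerivAt_hypJS 0).continuousAt.tendsto.mono_left
      nhdsWithin_le_nhds
  · simpa only [hypH2_zero] using (hasDerivAt_hypH2 0).continuousAt.tendsto.mono_left
      nhdsWithin_le_nhds
  · simpa only [deriv_hypJS_div_deriv_hypH2] using tendsto_div_sinh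

theorem fJS_eq_mul_log {t : ℝ} (ht : 0 ≤ t) :
    fJS t = (t * Real.log t + (t + 1) * (Real.log 2 - Real.log (t + 1))) / 2 := by
  have h1 : t + 1 ≠ 0 := by positivity
  rcases ht.eq_or_lt with rfl | ht
  · simp [fJS]; ring
  · rw [fJS, Real.log_div (by positivity) h1, Real.log_div two_ne_zero h1,
      Real.log_mul two_ne_zero ht.ne']
    ring

theorem fJS_exp (x : ℝ) :
    fJS (Real.exp (-2 * x)) = (Real.exp (-2 * x) + 1) / 2 * hypJS x := by
  have hpos := Real.exp_pos (-2 * x)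
  have h2 : Real.exp (-x) = Real.exp (-2 * x) * Real.exp x := by
    rw [← Real.exp_add]; ring_nf
  have hc : Real.cosh x = Real.exp x * (Real.exp (-2 * x) + 1) / 2 := by
    rw [Real.cosh_eq, h2]; ring
  have hs : Real.sinh x = Real.exp x * (1 - Real.exp (-2 * x)) / 2 := by
    rw [Real.sinh_eq, h2]; ring
  have he := Real.exp_pos x
  rw [fJS_eq_mul_log hpos.le, hypJS, hc, hs, Real.log_div (by positivity) two_ne_zero,
    Real.log_mul he.ne' (by positivity), Real.log_exp, Real.log_exp]
  field_simp
  ring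

theorem fH2_exp (x : ℝ) :
    fH2 (Real.exp (-2 * x)) = (Real.exp (-2 * x) + 1) / 2 * hypH2 x := by
  have he := Real.exp_pos x
  have h1 : Real.exp (-2 * x) = (Real.exp (-x)) ^ 2 := by
    rw [← Real.exp_nat_mul]; push_cast; ring_nf
  rw [fH2, hypH2, h1, Real.sqrt_sq (Real.exp_pos _).le, Real.cosh_eq, Real.exp_neg]
  field_simp
  ring

theorem xiJS_exp (x : ℝ) : xiJS (Real.exp (-2 * x)) = hypJS x / hypH2 x := by
  rw [xiJS, fJS_exp, fH2_exp, mul_div_mul_left _ _ (by positivity)]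

theorem xiJS_eq {t : ℝ} (ht : 0 < t) :
    xiJS t = hypJS (-Real.log t / 2) / hypH2 (-Real.log t / 2) := by
  rw [← xiJS_exp]
  ring_nf
  rw [Real.exp_log ht]

theorem xiJS_inv {t : ℝ} (ht : 0 < t) : xiJS t⁻¹ = xiJS t := by
  rw [xiJS_eq ht, xiJS_eq (inv_pos.2 ht), Real.log_inv, neg_div _ (-Real.log t)]
  simp only [hypJS, hypH2, Real.sinh_neg, Real.cosh_neg]
  ring

theorem fH2_pos {t : ℝ} (h1 : t ≠ 1) : 0 < fH2 t := by
  have : Real.sqrt t - 1 ≠ 0 := by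
    rw [sub_ne_zero, Ne, Real.sqrt_eq_one]; exact h1
  unfold fH2
  positivity

theorem tendsto_xiJS_one : Tendsto xiJS (nhdsWithin 1 {(1 : ℝ)}ᶜ) (nhds 1) := by
  have hlog : Tendsto (fun t => -Real.log t / 2) (nhdsWithin 1 {(1 : ℝ)}ᶜ)
      (nhdsWithin 0 {(0 : ℝ)}ᶜ) := by
    refine tendsto_nhdsWithin_iff.2 ⟨?_, ?_⟩
    · have : ContinuousAt (fun t => -Real.log t / 2) 1 :=
        (Real.continuousAt_log one_ne_zero).neg.div_const 2
      simpa using this.tendsto.mono_left nhdsWithin_le_nhds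
    · filter_upwards [self_mem_nhdsWithin, nhdsWithin_le_nhds (lt_mem_nhds one_pos)] with t h1 h0
      have := Real.log_ne_zero_of_pos_of_ne_one h0 h1
      simpa using this
  refine (tendsto_hypJS_div_hypH2.comp hlog).congr' ?_
  filter_upwards [nhdsWithin_le_nhds (lt_mem_nhds one_pos)] with t ht
  exact (xiJS_eq ht).symm

theorem tendsto_xiJS_zero :
    Tendsto xiJS (nhdsWithin 0 (Set.Ioi 0)) (nhds (Real.log 2)) := by
  have hc : ContinuousAt (fun t : ℝ =>
      (t * Real.log t + (t + 1) * (Real.log 2 - Real.log (t + 1))) / 2 / fH2 t) 0 := by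
    have h1 : ContinuousAt (fun t : ℝ => t * Real.log t) 0 := Real.continuous_mul_log.continuousAt
    have h2 : ContinuousAt (fun t : ℝ => Real.log (t + 1)) 0 :=
      ContinuousAt.log (by fun_prop) (by norm_num)
    have h3 : ContinuousAt fH2 0 := by unfold fH2; fun_prop
    exact ((h1.add ((by fun_prop : ContinuousAt (fun t : ℝ => t + 1) 0).mul
      (continuousAt_const.sub h2))).div_const 2).div h3 (fH2_pos zero_ne_one).ne'
  have h := hc.tendsto.mono_left (nhdsWithin_le_nhds (s := Set.Ioi 0))
  have hv : (0 * Real.log 0 + (0 + 1) * (Real.log 2 - Real.log (0 + 1))) / 2 / fH2 0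
      = Real.log 2 := by
    simp [fH2]
  rw [hv] at h
  refine h.congr' ?_
  filter_upwards [self_mem_nhdsWithin] with t ht
  rw [xiJS, fJS_eq_mul_log (le_of_lt ht)]

theorem tendsto_xiJS_atTop : Tendsto xiJS atTop (nhds (Real.log 2)) := by
  refine (tendsto_xiJS_zero.comp tendsto_inv_atTop_nhdsGT_zero).congr' ?_
  filter_upwards [eventually_gt_atTop 0] with t ht
  exact xiJS_inv ht

theorem fJS_zero : fJS 0 = (1 / 2) * Real.log 2 := by simp [fJS]

theorem xiJS_zero : xiJS 0 = Real.log 2 := by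
  simp [xiJS, fJS, fH2]
  ring

theorem strictMonoOn_xiJS_Ioo : StrictMonoOn xiJS (Set.Ioo 0 1) := by
  intro s hs t ht hst
  rw [xiJS_eq hs.1, xiJS_eq ht.1]
  have hl := Real.log_lt_log hs.1 hst
  have := Real.log_neg hs.1 hs.2
  have := Real.log_neg ht.1 ht.2
  exact strictAntiOn_hypJS_div_hypH2 (Set.mem_Ioi.2 (by linarith)) (Set.mem_Ioi.2 (by linarith))
    (by linarith)

theorem log_two_lt_xiJS {t : ℝ} (ht : t ∈ Set.Ioo (0 : ℝ) 1) : Real.log 2 < xiJS t := by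
  have h2 : t / 2 ∈ Set.Ioo (0 : ℝ) 1 := ⟨by linarith [ht.1], by linarith [ht.1, ht.2]⟩
  refine lt_of_le_of_lt (le_of_tendsto tendsto_xiJS_zero ?_)
    (strictMonoOn_xiJS_Ioo h2 ht (by linarith [ht.1]))
  filter_upwards [Ioo_mem_nhdsGT h2.1] with s hs
  exact (strictMonoOn_xiJS_Ioo ⟨hs.1, hs.2.trans h2.2⟩ h2 hs.2).le

theorem xiJS_le_one {t : ℝ} (ht : t ∈ Set.Ioo (0 : ℝ) 1) : xiJS t ≤ 1 := by
  have h : Tendsto xiJS (nhdsWithin 1 (Set.Iio 1)) (nhds 1) :=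
    tendsto_xiJS_one.mono_left (nhdsWithin_mono 1 fun x (hx : x < 1) => hx.ne)
  refine ge_of_tendsto h ?_
  filter_upwards [Ioo_mem_nhdsLT ht.2] with s hs
  exact (strictMonoOn_xiJS_Ioo ht ⟨ht.1.trans hs.1, hs.2⟩ hs.1).le

theorem xiJS_mem_Icc {t : ℝ} (ht : 0 ≤ t) (h1 : t ≠ 1) : xiJS t ∈ Set.Icc (Real.log 2) 1 := by
  rcases ht.eq_or_lt with rfl | ht
  · rw [xiJS_zero]
    exact ⟨le_rfl, by linarith [Real.log_two_lt_d9]⟩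
  rcases h1.lt_or_gt with h1 | h1
  · exact ⟨(log_two_lt_xiJS ⟨ht, h1⟩).le, xiJS_le_one ⟨ht, h1⟩⟩
  · have h : t⁻¹ ∈ Set.Ioo (0 : ℝ) 1 := ⟨inv_pos.2 ht, inv_lt_one_of_one_lt₀ h1⟩
    rw [← xiJS_inv ht]
    exact ⟨(log_two_lt_xiJS h).le, xiJS_le_one h⟩

theorem strictMonoOn_xiJS_Ico : StrictMonoOn xiJS (Set.Ico 0 1) := by
  intro s hs t ht hst
  rcases hs.1.eq_or_lt with rfl | h0
  · rw [xiJS_zero]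
    exact log_two_lt_xiJS ⟨hst, ht.2⟩
  · exact strictMonoOn_xiJS_Ioo ⟨h0, hs.2⟩ ⟨h0.trans hst, ht.2⟩ hst

theorem strictAntiOn_xiJS_Ioi : StrictAntiOn xiJS (Set.Ioi 1) := by
  intro s hs t ht hst
  have hs0 : 0 < s := one_pos.trans hs
  have ht0 : 0 < t := one_pos.trans ht
  rw [← xiJS_inv hs0, ← xiJS_inv ht0]
  exact strictMonoOn_xiJS_Ioo ⟨inv_pos.2 ht0, inv_lt_one_of_one_lt₀ ht⟩
    ⟨inv_pos.2 hs0, inv_lt_one_of_one_lt₀ hs⟩ (inv_strictAnti₀ hs0 hst)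

/-- Pointwise comparison of the Jensen-Shannon and squared-Hellinger generators:
`(ln 2) · (1/2)(√t - 1)² ≤ fJS t ≤ (1/2)(√t - 1)²` for all `t ≥ 0` (at `t = 0` the middle
expression equals its limit `(1/2) ln 2`), together with the monotonicity and limit
properties of the quotient `ξ`. -/
theorem fJS_between_log_two_mul_fH2_and_fH2 :
    (∀ t : ℝ, 0 ≤ t → Real.log 2 * fH2 t ≤ fJS t ∧ fJS t ≤ fH2 t) ∧
    fJS 0 = (1/2) * Real.log 2 ∧
    StrictMonoOn xiJS (Set.Ico (0:ℝ) 1) ∧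
    StrictAntiOn xiJS (Set.Ioi (1:ℝ)) ∧
    Tendsto xiJS (nhdsWithin 0 (Set.Ioi 0)) (nhds (Real.log 2)) ∧
    Tendsto xiJS (nhdsWithin 1 {(1:ℝ)}ᶜ) (nhds 1) ∧
    Tendsto xiJS atTop (nhds (Real.log 2)) := by
  refine ⟨fun t ht => ?_, fJS_zero, strictMonoOn_xiJS_Ico, strictAntiOn_xiJS_Ioi,
    tendsto_xiJS_zero, tendsto_xiJS_one, tendsto_xiJS_atTop⟩
  by_cases h1 : t = 1
  · subst h1
    norm_num [fJS, fH2]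
  · have hp := fH2_pos h1
    have h := xiJS_mem_Icc ht h1
    exact ⟨(le_div_iff₀ hp).1 h.1, by simpa using (div_le_iff₀ hp).1 h.2⟩
end
end

section
/- Let P and Q be probability measures on Ω₁×⋯×Ω_n (standard Borel spaces) that are both Bayes-nets with respect to a common DAG G with topological ordering (1,…,n) and parent sets Π_i ⊆ {1,…,i−1}. Then the Jensen–Shannon divergence (with natural logarithm) satisfies JS(P,Q) ≤ (1/ln 2)·Σ_{i=1}^n JS(P_{X_i∪X_{Π_i}}, Q_{X_i∪X_{Π_i}}). -/
open MeasureTheory ProbabilityTheory Filter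
open scoped ENNReal NNReal

noncomputable section

universe u

/-- The Jensen-Shannon divergence (with natural logarithm)
`JS(P,Q) = (1/2) KL(P, (P+Q)/2) + (1/2) KL(Q, (P+Q)/2)`. -/
def jsDiv {Ω : Type*} [MeasurableSpace Ω] (P Q : Measure Ω) : ℝ≥0∞ :=
  (2:ℝ≥0∞)⁻¹ * klDiv P ((2:ℝ≥0∞)⁻¹ • (P + Q))
    + (2:ℝ≥0∞)⁻¹ * klDiv Q ((2:ℝ≥0∞)⁻¹ • (P + Q))

lemma hasDerivAt_sqrt_one_sub_sq {t : ℝ} (h : 0 < 1 - t ^ 2) :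
    HasDerivAt (fun t : ℝ => √(1 - t ^ 2)) (-t / √(1 - t ^ 2)) t := by
  have h1 : HasDerivAt (fun t : ℝ => 1 - t ^ 2) (-(2 * t)) t := by
    simpa using ((hasDerivAt_id t).pow 2).const_sub 1
  convert h1.sqrt h.ne' using 1
  have := Real.sqrt_pos.2 h
  field_simp

/-- The Jensen-Shannon integrand at the pair of densities `(1 + t, 1 - t)`. -/
def jsIntegrand (t : ℝ) : ℝ :=
  ((1 + t) * Real.log (1 + t) + (1 - t) * Real.log (1 - t)) / 2

lemma continuous_jsIntegrand : Continuous jsIntegrand := by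
  unfold jsIntegrand
  have h1 : Continuous fun t : ℝ => (1 + t) * Real.log (1 + t) :=
    Real.continuous_mul_log.comp (by fun_prop : Continuous fun t : ℝ => 1 + t)
  have h2 : Continuous fun t : ℝ => (1 - t) * Real.log (1 - t) :=
    Real.continuous_mul_log.comp (by fun_prop : Continuous fun t : ℝ => 1 - t)
  exact (h1.add h2).div_const 2

lemma hasDerivAt_jsIntegrand {t : ℝ} (h1 : 0 < 1 + t) (h2 : 0 < 1 - t) :
    HasDerivAt jsIntegrand ((Real.log (1 + t) - Real.log (1 - t)) / 2) t := by
  have a : HasDerivAt (fun t : ℝ => (1 + t) * Real.log (1 + t)) (Real.log (1 + t) + 1) t := by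
    exact ((Real.hasDerivAt_mul_log h1.ne').comp t ((hasDerivAt_id t).const_add 1)).congr_deriv
      (by ring)
  have b : HasDerivAt (fun t : ℝ => (1 - t) * Real.log (1 - t)) (-(Real.log (1 - t) + 1)) t := by
    exact ((Real.hasDerivAt_mul_log h2.ne').comp t ((hasDerivAt_id t).const_sub 1)).congr_deriv
      (by ring)
  exact ((a.add b).div_const 2).congr_deriv (by ring)

lemma log_sub_log_le {t : ℝ} (h0 : 0 ≤ t) (h1 : t < 1) :
    (Real.log (1 + t) - Real.log (1 - t)) / 2 ≤ t / √(1 - t ^ 2) := by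
  have hp : 0 < 1 + t := by linarith
  have hm : 0 < 1 - t := by linarith
  have ha := Real.sqrt_pos.2 hp
  have hb := Real.sqrt_pos.2 hm
  have hx : 1 ≤ √(1 + t) / √(1 - t) := by
    rw [one_le_div hb]; exact Real.sqrt_le_sqrt (by linarith)
  have key := Real.self_le_sinh_iff.2 (Real.log_nonneg hx)
  rw [Real.sinh_log (by positivity), Real.log_div ha.ne' hb.ne', Real.log_sqrt hp.le,
    Real.log_sqrt hm.le] at key
  have e : (1 - t ^ 2) = (1 + t) * (1 - t) := by ring
  rw [e, Real.sqrt_mul hp.le]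
  refine (by linarith : _ ≤ _).trans (key.trans_eq ?_)
  field_simp
  rw [Real.sq_sqrt hp.le, Real.sq_sqrt hm.le]
  ring

lemma jsIntegrand_neg (t : ℝ) : jsIntegrand (-t) = jsIntegrand t := by
  unfold jsIntegrand
  rw [sub_neg_eq_add, ← sub_eq_add_neg]; ring

lemma jsIntegrand_le {t : ℝ} (ht : |t| ≤ 1) : jsIntegrand t ≤ 1 - √(1 - t ^ 2) := by
  wlog h0 : 0 ≤ t generalizing t
  · simpa [jsIntegrand_neg] using this (t := -t) (by simpa using ht) (by linarith)
  rw [abs_of_nonneg h0] at ht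
  have hmono : MonotoneOn (fun t => 1 - √(1 - t ^ 2) - jsIntegrand t) (Set.Icc 0 1) := by
    have hd : ∀ x ∈ interior (Set.Icc (0 : ℝ) 1),
        HasDerivAt (fun t => 1 - √(1 - t ^ 2) - jsIntegrand t)
          (x / √(1 - x ^ 2) - (Real.log (1 + x) - Real.log (1 - x)) / 2) x := by
      intro x hx
      rw [interior_Icc] at hx
      have := ((hasDerivAt_sqrt_one_sub_sq (t := x) (by nlinarith [hx.1, hx.2])).const_sub 1).sub
        (hasDerivAt_jsIntegrand (t := x) (by linarith [hx.1]) (by linarith [hx.2]))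
      exact this.congr_deriv (by ring)
    refine monotoneOn_of_deriv_nonneg (convex_Icc _ _) ?_ ?_ ?_
    · have := continuous_jsIntegrand
      fun_prop
    · exact fun x hx => (hd x hx).differentiableAt.differentiableWithinAt
    · intro x hx
      rw [(hd x hx).deriv]
      rw [interior_Icc] at hx
      exact sub_nonneg.2 (log_sub_log_le hx.1.le hx.2)
  have := hmono (Set.left_mem_Icc.2 zero_le_one) ⟨h0, ht⟩ h0
  simp [jsIntegrand] at this
  simp [jsIntegrand]
  linarith

lemma log_two_mul_le_jsIntegrand {t : ℝ} (ht : |t| ≤ 1) :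
    Real.log 2 * (1 - √(1 - t ^ 2)) ≤ jsIntegrand t := by
  wlog h0 : 0 ≤ t generalizing t
  · simpa [jsIntegrand_neg] using this (t := -t) (by simpa using ht) (by linarith)
  rw [abs_of_nonneg h0] at ht
  have hc0 : 0 < Real.log 2 := Real.log_pos one_lt_two
  have hc1 : Real.log 2 < 1 := by linarith [Real.log_two_lt_d9]
  set c := Real.log 2 with hc
  set d : ℝ → ℝ := fun t => jsIntegrand t - c * (1 - √(1 - t ^ 2)) with hd
  set e : ℝ → ℝ := fun t =>
    (Real.log (1 + t) - Real.log (1 - t)) / 2 - c * (t / √(1 - t ^ 2)) with he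
  set t₀ := √(1 - c ^ 2) with ht₀
  have ht₀sq : t₀ ^ 2 = 1 - c ^ 2 := Real.sq_sqrt (by nlinarith)
  have ht₀0 : 0 ≤ t₀ := Real.sqrt_nonneg _
  have ht₀1 : t₀ < 1 := by nlinarith
  have hcont : Continuous d := by
    have := continuous_jsIntegrand
    fun_prop
  have hdd : ∀ x, 0 ≤ x → x < 1 → HasDerivAt d (e x) x := by
    intro x hx0 hx1
    have := (hasDerivAt_jsIntegrand (t := x) (by linarith) (by linarith)).sub
      (((hasDerivAt_sqrt_one_sub_sq (t := x) (by nlinarith)).const_sub 1).const_mul c)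
    exact this.congr_deriv (by simp only [he]; ring)
  have hed : ∀ x, 0 ≤ x → x < 1 →
      HasDerivAt e ((√(1 - x ^ 2) - c) / √(1 - x ^ 2) ^ 3) x := by
    intro x hx0 hx1
    have hx2 : 0 < 1 - x ^ 2 := by nlinarith
    have hs := Real.sqrt_pos.2 hx2
    have a : HasDerivAt (fun t : ℝ => Real.log (1 + t)) (1 / (1 + x)) x :=
      ((hasDerivAt_id x).const_add 1).log (by simpa using by linarith)
    have b : HasDerivAt (fun t : ℝ => Real.log (1 - t)) (-1 / (1 - x)) x :=
      ((hasDerivAt_id x).const_sub 1).log (by simpa using by linarith)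
    have := ((a.sub b).div_const 2).sub
      (((hasDerivAt_id x).div (hasDerivAt_sqrt_one_sub_sq hx2) hs.ne').const_mul c)
    refine this.congr_deriv ?_
    have hp : 1 + x ≠ 0 := by linarith
    have hm : 1 - x ≠ 0 := by linarith
    have hsq := Real.sq_sqrt hx2.le
    have e1 : (1 / (1 + x) - -1 / (1 - x)) / 2 = 1 / √(1 - x ^ 2) ^ 2 := by
      rw [hsq]
      have : 1 - x ^ 2 ≠ 0 := hx2.ne'
      field_simp
      ring
    rw [e1]
    simp only [id]
    have e2 : x ^ 2 = 1 - √(1 - x ^ 2) ^ 2 := by rw [hsq]; ring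
    generalize √(1 - x ^ 2) = s at *
    field_simp
    rw [e2]
    ring
  have hmono : MonotoneOn e (Set.Icc 0 t₀) := by
    refine monotoneOn_of_deriv_nonneg (convex_Icc _ _) ?_ ?_ ?_
    · exact fun x hx => (hed x hx.1 (hx.2.trans_lt ht₀1)).continuousAt.continuousWithinAt
    · intro x hx
      rw [interior_Icc] at hx
      exact (hed x hx.1.le (hx.2.trans ht₀1)).differentiableAt.differentiableWithinAt
    · intro x hx
      rw [interior_Icc] at hx
      rw [(hed x hx.1.le (hx.2.trans ht₀1)).deriv]
      have : c ≤ √(1 - x ^ 2) := Real.le_sqrt_of_sq_le (by nlinarith [hx.1, hx.2])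
      have : 0 ≤ √(1 - x ^ 2) - c := by linarith
      positivity
  have hanti : AntitoneOn e (Set.Ico t₀ 1) := by
    refine antitoneOn_of_deriv_nonpos (convex_Ico _ _) ?_ ?_ ?_
    · exact fun x hx => (hed x (ht₀0.trans hx.1) hx.2).continuousAt.continuousWithinAt
    · intro x hx
      rw [interior_Ico] at hx
      exact (hed x (ht₀0.trans hx.1.le) hx.2).differentiableAt.differentiableWithinAt
    · intro x hx
      rw [interior_Ico] at hx
      rw [(hed x (ht₀0.trans hx.1.le) hx.2).deriv]
      have : √(1 - x ^ 2) ≤ c := Real.sqrt_le_iff.2 ⟨hc0.le, by nlinarith [hx.1, hx.2]⟩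
      exact div_nonpos_of_nonpos_of_nonneg (by linarith) (by positivity)
  have hd0 : d 0 = 0 := by simp [hd, jsIntegrand]
  have hd1 : d 1 = 0 := by
    simp only [hd, jsIntegrand]
    norm_num [← hc]
  have hleft : ∀ x ∈ Set.Icc 0 t₀, 0 ≤ d x := by
    have : MonotoneOn d (Set.Icc 0 t₀) := by
      refine monotoneOn_of_deriv_nonneg (convex_Icc _ _) hcont.continuousOn ?_ ?_
      · intro x hx
        rw [interior_Icc] at hx
        exact (hdd x hx.1.le (hx.2.trans ht₀1)).differentiableAt.differentiableWithinAt
      · intro x hx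
        rw [interior_Icc] at hx
        rw [(hdd x hx.1.le (hx.2.trans ht₀1)).deriv]
        have h := hmono (Set.left_mem_Icc.2 ht₀0) ⟨hx.1.le, hx.2.le⟩ hx.1.le
        simpa [he] using h
    intro x hx
    exact hd0 ▸ this (Set.left_mem_Icc.2 ht₀0) hx hx.1
  suffices 0 ≤ d t by simp only [hd] at this; linarith
  rcases le_total t t₀ with h | h
  · exact hleft t ⟨h0, h⟩
  · have hconc : ConcaveOn ℝ (Set.Icc t₀ 1) d := by
      refine AntitoneOn.concaveOn_of_deriv (convex_Icc _ _) hcont.continuousOn ?_ ?_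
      · intro x hx
        rw [interior_Icc] at hx
        exact (hdd x (ht₀0.trans hx.1.le) hx.2).differentiableAt.differentiableWithinAt
      · intro x hx y hy hxy
        rw [interior_Icc] at hx hy
        rw [(hdd x (ht₀0.trans hx.1.le) hx.2).deriv, (hdd y (ht₀0.trans hy.1.le) hy.2).deriv]
        exact hanti ⟨hx.1.le, hx.2⟩ ⟨hy.1.le, hy.2⟩ hxy
    have := hconc.min_le_of_mem_Icc (Set.left_mem_Icc.2 ht₀1.le) (Set.right_mem_Icc.2 ht₀1.le)
      ⟨h, ht⟩
    rw [hd1] at this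
    exact (le_min (hleft t₀ ⟨ht₀0, le_rfl⟩) le_rfl).trans this

/-- The midpoint of two measures. -/
def midMeasure {X : Type*} [MeasurableSpace X] (μ ν : Measure X) : Measure X :=
  (2:ℝ≥0∞)⁻¹ • (μ + ν)

section Mid
variable {X : Type*} [MeasurableSpace X] (μ ν : Measure X)

instance [IsProbabilityMeasure μ] [IsProbabilityMeasure ν] :
    IsProbabilityMeasure (midMeasure μ ν) :=
  ⟨by simp [midMeasure, ENNReal.inv_two_add_inv_two]⟩

lemma absolutelyContinuous_midMeasure_left : μ ≪ midMeasure μ ν := by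
  intro s hs
  simp [midMeasure] at hs
  exact hs.1

lemma absolutelyContinuous_midMeasure_right : ν ≪ midMeasure μ ν := by
  intro s hs
  simp [midMeasure] at hs
  exact hs.2

end Mid

/-- The geometric mean on `ℝ≥0∞`. -/
def geomMean (a b : ℝ≥0∞) : ℝ≥0∞ := (a * b) ^ (2⁻¹ : ℝ)

lemma geomMean_mul_mul (a b c d : ℝ≥0∞) :
    geomMean (a * c) (b * d) = geomMean a b * geomMean c d := by
  simp only [geomMean]
  rw [mul_mul_mul_comm, ENNReal.mul_rpow_of_nonneg _ _ (by norm_num)]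

lemma geomMean_self (a : ℝ≥0∞) : geomMean a a = a := by
  simp only [geomMean]
  rw [← sq, ← ENNReal.rpow_natCast, ← ENNReal.rpow_mul]
  norm_num

lemma geomMean_le (a b : ℝ≥0∞) : geomMean a b ≤ 2⁻¹ * (a + b) := by
  simp only [geomMean]
  rw [ENNReal.mul_rpow_of_nonneg _ _ (by norm_num)]
  refine (ENNReal.young_inequality _ _ Real.HolderConjugate.two_two).trans_eq ?_
  rw [← ENNReal.rpow_mul, ← ENNReal.rpow_mul]
  norm_num
  rw [mul_add, ENNReal.div_eq_inv_mul, ENNReal.div_eq_inv_mul]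

@[fun_prop]
lemma Measurable.geomMean {X : Type*} [MeasurableSpace X] {f g : X → ℝ≥0∞}
    (hf : Measurable f) (hg : Measurable g) : Measurable fun x => geomMean (f x) (g x) :=
  (hf.mul hg).pow_const _

/-- The Hellinger affinity (Bhattacharyya coefficient) `∫ √(dμ dν)`. -/
def hellingerAffinity {X : Type*} [MeasurableSpace X] (μ ν : Measure X) : ℝ≥0∞ :=
  ∫⁻ x, geomMean (μ.rnDeriv (midMeasure μ ν) x) (ν.rnDeriv (midMeasure μ ν) x) ∂(midMeasure μ ν)

section Affinity
variable {X Y A : Type*} [MeasurableSpace X] [MeasurableSpace Y] [MeasurableSpace A]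

lemma withDensity_rnDeriv_midMeasure_left (μ ν : Measure X) [IsProbabilityMeasure μ]
    [IsProbabilityMeasure ν] :
    (midMeasure μ ν).withDensity (μ.rnDeriv (midMeasure μ ν)) = μ :=
  Measure.withDensity_rnDeriv_eq _ _ (absolutelyContinuous_midMeasure_left μ ν)

lemma withDensity_rnDeriv_midMeasure_right (μ ν : Measure X) [IsProbabilityMeasure μ]
    [IsProbabilityMeasure ν] :
    (midMeasure μ ν).withDensity (ν.rnDeriv (midMeasure μ ν)) = ν :=
  Measure.withDensity_rnDeriv_eq _ _ (absolutelyContinuous_midMeasure_right μ ν)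

/-- The Hellinger affinity may be computed with respect to any dominating measure. -/
lemma hellingerAffinity_eq_lintegral {μ ν m : Measure X} [SigmaFinite m] [IsProbabilityMeasure μ]
    [IsProbabilityMeasure ν] {p q : X → ℝ≥0∞} (hp : Measurable p) (hq : Measurable q)
    (hμ : m.withDensity p = μ) (hν : m.withDensity q = ν) :
    hellingerAffinity μ ν = ∫⁻ x, geomMean (p x) (q x) ∂m := by
  set p' := μ.rnDeriv (midMeasure μ ν)
  set q' := ν.rnDeriv (midMeasure μ ν)
  have hp' : Measurable p' := Measure.measurable_rnDeriv _ _
  have hq' : Measurable q' := Measure.measurable_rnDeriv _ _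
  set r : X → ℝ≥0∞ := (2:ℝ≥0∞)⁻¹ • (p + q)
  have hr : Measurable r := (hp.add hq).const_smul _
  have hM : midMeasure μ ν = m.withDensity r := by
    rw [withDensity_smul _ (hp.add hq), withDensity_add_left hp, hμ, hν, midMeasure]
  have h1 : r * p' =ᵐ[m] p := by
    rw [← withDensity_eq_iff_of_sigmaFinite (hr.mul hp').aemeasurable hp.aemeasurable,
      withDensity_mul _ hr hp', ← hM, withDensity_rnDeriv_midMeasure_left, hμ]
  have h2 : r * q' =ᵐ[m] q := by
    rw [← withDensity_eq_iff_of_sigmaFinite (hr.mul hq').aemeasurable hq.aemeasurable,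
      withDensity_mul _ hr hq', ← hM, withDensity_rnDeriv_midMeasure_right, hν]
  change ∫⁻ x, geomMean (p' x) (q' x) ∂(midMeasure μ ν) = _
  rw [hM, lintegral_withDensity_eq_lintegral_mul _ hr (by fun_prop)]
  refine lintegral_congr_ae ?_
  filter_upwards [h1, h2] with x hx1 hx2
  rw [← hx1, ← hx2]
  simp only [Pi.mul_apply]
  rw [geomMean_mul_mul, geomMean_self]

lemma hellingerAffinity_self (μ : Measure X) [IsProbabilityMeasure μ] :
    hellingerAffinity μ μ = 1 := by
  rw [hellingerAffinity_eq_lintegral (m := μ) (p := 1) (q := 1) measurable_one measurable_one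
    withDensity_one withDensity_one]
  simp [geomMean_self]

lemma hellingerAffinity_le_one (μ ν : Measure X) [IsProbabilityMeasure μ]
    [IsProbabilityMeasure ν] : hellingerAffinity μ ν ≤ 1 := by
  refine (lintegral_mono fun x => geomMean_le _ _).trans ?_
  rw [lintegral_const_mul _ (by fun_prop), lintegral_add_left (by fun_prop),
    Measure.lintegral_rnDeriv (absolutelyContinuous_midMeasure_left μ ν),
    Measure.lintegral_rnDeriv (absolutelyContinuous_midMeasure_right μ ν)]
  simp [one_add_one_eq_two, ENNReal.inv_mul_cancel]

/-- A density of a finite measure is almost everywhere nonzero and finite. -/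
lemma ae_density_ne {μ m : Measure X} [IsFiniteMeasure μ] {p : X → ℝ≥0∞} (hp : Measurable p)
    (hμ : m.withDensity p = μ) : ∀ᵐ x ∂μ, p x ≠ 0 ∧ p x ≠ ∞ := by
  have hfin : ∀ᵐ x ∂m, p x < ∞ := by
    refine ae_lt_top hp ?_
    rw [← setLIntegral_univ, ← withDensity_apply _ MeasurableSet.univ, hμ]
    exact measure_ne_top _ _
  have : ∀ᵐ x ∂(m.withDensity p), p x ≠ 0 ∧ p x ≠ ∞ := by
    rw [ae_withDensity_iff hp]
    filter_upwards [hfin] with x hx h0 using ⟨h0, hx.ne⟩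
  rwa [hμ] at this

/-- Weighted data processing inequality for the Hellinger affinity. -/
lemma lintegral_geomMean_mul_comp_le {μ ν m : Measure X} [IsFiniteMeasure μ]
    [IsFiniteMeasure ν] {m' : Measure Y} {T : X → Y} (hT : Measurable T)
    {p q : X → ℝ≥0∞} (hp : Measurable p) (hq : Measurable q)
    (hμ : m.withDensity p = μ) (hν : m.withDensity q = ν)
    {u v : Y → ℝ≥0∞} (hu : Measurable u) (hv : Measurable v)
    (hμ' : m'.withDensity u = μ.map T) (hν' : m'.withDensity v = ν.map T)
    {φ : Y → ℝ≥0∞} (hφ : Measurable φ) :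
    ∫⁻ x, geomMean (p x) (q x) * φ (T x) ∂m ≤ ∫⁻ y, geomMean (u y) (v y) * φ y ∂m' := by
  set t : Y → ℝ≥0∞ := fun y => (v y / u y) ^ (2⁻¹ : ℝ)
  set s : Y → ℝ≥0∞ := fun y => (u y / v y) ^ (2⁻¹ : ℝ)
  have ht : Measurable t := (hv.div hu).pow_const _
  have hs : Measurable s := (hu.div hv).pow_const _
  have gu : ∀ᵐ x ∂m, p x ≠ 0 → u (T x) ≠ 0 ∧ u (T x) ≠ ∞ := by
    rw [← ae_withDensity_iff hp, hμ]
    exact ae_of_ae_map hT.aemeasurable (ae_density_ne hu hμ')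
  have gv : ∀ᵐ x ∂m, q x ≠ 0 → v (T x) ≠ 0 ∧ v (T x) ≠ ∞ := by
    rw [← ae_withDensity_iff hq, hν]
    exact ae_of_ae_map hT.aemeasurable (ae_density_ne hv hν')
  have key : ∀ (w : X → ℝ≥0∞) (ρ : Measure X) (z : Y → ℝ≥0∞) (k : Y → ℝ≥0∞), Measurable w →
      Measurable z → Measurable k → m.withDensity w = ρ → m'.withDensity z = ρ.map T →
      ∫⁻ x, w x * k (T x) ∂m = ∫⁻ y, z y * k y ∂m' := by
    intro w ρ z k hw hz hk h1 h2
    calc ∫⁻ x, w x * k (T x) ∂m = ∫⁻ x, k (T x) ∂ρ := by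
          rw [← h1]; exact (lintegral_withDensity_eq_lintegral_mul _ hw (hk.comp hT)).symm
      _ = ∫⁻ y, k y ∂(ρ.map T) := (lintegral_map hk hT).symm
      _ = ∫⁻ y, z y * k y ∂m' := by
          rw [← h2]; exact lintegral_withDensity_eq_lintegral_mul _ hz hk
  calc ∫⁻ x, geomMean (p x) (q x) * φ (T x) ∂m
      ≤ ∫⁻ x, 2⁻¹ * (p x * (t (T x) * φ (T x)) + q x * (s (T x) * φ (T x))) ∂m := by
        refine lintegral_mono_ae ?_
        filter_upwards [gu, gv] with x hx1 hx2
        by_cases h0 : p x = 0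
        · simp [h0, geomMean]
        by_cases h0' : q x = 0
        · simp [h0', geomMean]
        obtain ⟨a0, aT⟩ := hx1 h0
        obtain ⟨b0, bT⟩ := hx2 h0'
        have hts : geomMean (t (T x)) (s (T x)) = 1 := by
          have : v (T x) / u (T x) * (u (T x) / v (T x)) = 1 := by
            rw [← ENNReal.inv_div (Or.inl aT) (Or.inl a0)]
            exact ENNReal.mul_inv_cancel (ENNReal.div_ne_zero.2 ⟨b0, aT⟩)
              (ENNReal.div_ne_top bT a0)
          simp only [geomMean, t, s]
          rw [← ENNReal.mul_rpow_of_nonneg _ _ (by norm_num), this]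
          simp
        calc geomMean (p x) (q x) * φ (T x)
            = geomMean (p x * t (T x)) (q x * s (T x)) * φ (T x) := by
              rw [geomMean_mul_mul, hts, mul_one]
          _ ≤ 2⁻¹ * (p x * t (T x) + q x * s (T x)) * φ (T x) := by
              gcongr; exact geomMean_le _ _
          _ = _ := by ring
    _ = 2⁻¹ * (∫⁻ y, u y * (t y * φ y) ∂m' + ∫⁻ y, v y * (s y * φ y) ∂m') := by
        rw [lintegral_const_mul _ (by fun_prop), lintegral_add_left (by fun_prop),
          key p μ u (fun y => t y * φ y) hp hu (by fun_prop) hμ hμ',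
          key q ν v (fun y => s y * φ y) hq hv (by fun_prop) hν hν']
    _ = ∫⁻ y, 2⁻¹ * (u y * (t y * φ y) + v y * (s y * φ y)) ∂m' := by
        rw [lintegral_const_mul _ (by fun_prop), lintegral_add_left (by fun_prop)]
    _ ≤ ∫⁻ y, geomMean (u y) (v y) * φ y ∂m' := by
        have ku : ∀ᵐ y ∂m', u y ≠ 0 → u y ≠ ∞ := by
          rw [← ae_withDensity_iff hu, hμ']
          exact (ae_density_ne hu hμ').mono fun _ h => h.2
        have kv : ∀ᵐ y ∂m', v y ≠ 0 → v y ≠ ∞ := by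
          rw [← ae_withDensity_iff hv, hν']
          exact (ae_density_ne hv hν').mono fun _ h => h.2
        have aux : ∀ a b : ℝ≥0∞, (a ≠ 0 → a ≠ ∞) →
            a * (b / a) ^ (2⁻¹ : ℝ) ≤ geomMean a b := by
          intro a b h
          by_cases ha : a = 0
          · simp [ha]
          conv_lhs => enter [1]; rw [← geomMean_self a]
          rw [geomMean, ← ENNReal.mul_rpow_of_nonneg _ _ (by norm_num), mul_assoc,
            ENNReal.mul_div_cancel ha (h ha), geomMean]
        refine lintegral_mono_ae ?_
        filter_upwards [ku, kv] with y h1 h2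
        have h3 := aux (u y) (v y) h1
        have h4 := aux (v y) (u y) h2
        rw [geomMean, mul_comm (v y) (u y), ← geomMean] at h4
        calc 2⁻¹ * (u y * (t y * φ y) + v y * (s y * φ y))
            = 2⁻¹ * (u y * t y + v y * s y) * φ y := by ring
          _ ≤ 2⁻¹ * (geomMean (u y) (v y) + geomMean (u y) (v y)) * φ y := by gcongr
          _ = _ := by
            rw [← two_mul, ← mul_assoc, ENNReal.inv_mul_cancel (by simp) (by simp), one_mul]

lemma hellingerAffinity_le_map (μ ν : Measure X) [IsProbabilityMeasure μ]
    [IsProbabilityMeasure ν] {T : X → Y} (hT : Measurable T) :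
    hellingerAffinity μ ν ≤ hellingerAffinity (μ.map T) (ν.map T) := by
  have := Measure.isProbabilityMeasure_map (μ := μ) hT.aemeasurable
  have := Measure.isProbabilityMeasure_map (μ := ν) hT.aemeasurable
  have := lintegral_geomMean_mul_comp_le hT (Measure.measurable_rnDeriv _ _)
    (Measure.measurable_rnDeriv _ _) (withDensity_rnDeriv_midMeasure_left μ ν)
    (withDensity_rnDeriv_midMeasure_right μ ν) (Measure.measurable_rnDeriv _ _)
    (Measure.measurable_rnDeriv _ _) (withDensity_rnDeriv_midMeasure_left (μ.map T) (ν.map T))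
    (withDensity_rnDeriv_midMeasure_right (μ.map T) (ν.map T)) (φ := 1) measurable_one
  simpa [hellingerAffinity] using this

lemma withDensity_compProd_withDensity {m : Measure X} [SFinite m] {η : Kernel X A}
    [IsSFiniteKernel η] {p : X → ℝ≥0∞} {k : X → A → ℝ≥0∞} (hp : Measurable p)
    (hk : Measurable (Function.uncurry k)) {μ : Measure X} [SFinite μ] {κ : Kernel X A}
    [IsSFiniteKernel κ] (hμ : m.withDensity p = μ) (hκ : ∀ x, (η x).withDensity (k x) = κ x) :
    (m ⊗ₘ η).withDensity (fun z => p z.1 * k z.1 z.2) = μ ⊗ₘ κ := by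
  have hpk : Measurable fun z : X × A => p z.1 * k z.1 z.2 :=
    (hp.comp measurable_fst).mul hk
  ext s hs
  rw [withDensity_apply _ hs, ← lintegral_indicator hs,
    Measure.lintegral_compProd (hpk.indicator hs), Measure.compProd_apply hs, ← hμ,
    lintegral_withDensity_eq_lintegral_mul _ hp (Kernel.measurable_kernel_prodMk_left hs)]
  refine lintegral_congr fun x => ?_
  have hsx : MeasurableSet (Prod.mk x ⁻¹' s) := measurable_prodMk_left hs
  rw [Pi.mul_apply, ← hκ, withDensity_apply _ hsx, ← lintegral_indicator hsx,
    ← lintegral_const_mul _ ((show Measurable (k x) from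
      hk.comp measurable_prodMk_left).indicator hsx)]
  refine lintegral_congr fun a => ?_
  by_cases h : (x, a) ∈ s <;> simp [Set.indicator, h]

/-- Subadditivity of the squared Hellinger distance along a Markov chain `X → Y → A`, where `Y` is
a function of `X`, stated with affinities. -/
lemma hellingerAffinity_add_le (μ ν : Measure X) [IsProbabilityMeasure μ]
    [IsProbabilityMeasure ν] {T : X → Y} (hT : Measurable T)
    [MeasurableSpace.CountableOrCountablyGenerated Y A]
    (κ ξ : Kernel Y A) [IsMarkovKernel κ] [IsMarkovKernel ξ] :
    hellingerAffinity μ ν + hellingerAffinity (μ.map T ⊗ₘ κ) (ν.map T ⊗ₘ ξ)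
      ≤ 1 + hellingerAffinity (μ ⊗ₘ κ.comap T hT) (ν ⊗ₘ ξ.comap T hT) := by
  have := Measure.isProbabilityMeasure_map (μ := μ) hT.aemeasurable
  have := Measure.isProbabilityMeasure_map (μ := ν) hT.aemeasurable
  set M := midMeasure μ ν
  set p := μ.rnDeriv M
  set q := ν.rnDeriv M
  have hp : Measurable p := Measure.measurable_rnDeriv _ _
  have hq : Measurable q := Measure.measurable_rnDeriv _ _
  have hμ : M.withDensity p = μ := withDensity_rnDeriv_midMeasure_left μ ν
  have hν : M.withDensity q = ν := withDensity_rnDeriv_midMeasure_right μ ν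
  set M' := midMeasure (μ.map T) (ν.map T)
  set u := (μ.map T).rnDeriv M'
  set v := (ν.map T).rnDeriv M'
  have hu : Measurable u := Measure.measurable_rnDeriv _ _
  have hv : Measurable v := Measure.measurable_rnDeriv _ _
  have hμ' : M'.withDensity u = μ.map T := withDensity_rnDeriv_midMeasure_left _ _
  have hν' : M'.withDensity v = ν.map T := withDensity_rnDeriv_midMeasure_right _ _
  set η : Kernel Y A := κ + ξ
  set k := Kernel.rnDeriv κ η
  set l := Kernel.rnDeriv ξ η
  have hk : Measurable (Function.uncurry k) := Kernel.measurable_rnDeriv _ _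
  have hl : Measurable (Function.uncurry l) := Kernel.measurable_rnDeriv _ _
  have hκ : ∀ y, (η y).withDensity (k y) = κ y := fun y => by
    have h : κ y ≪ η y := (Measure.le_add_right le_rfl : κ y ≤ κ y + ξ y).absolutelyContinuous
    rw [← Kernel.withDensity_apply _ hk, Kernel.withDensity_rnDeriv_eq h]
  have hξ : ∀ y, (η y).withDensity (l y) = ξ y := fun y => by
    have h : ξ y ≪ η y := (Measure.le_add_left le_rfl : ξ y ≤ κ y + ξ y).absolutelyContinuous
    rw [← Kernel.withDensity_apply _ hl, Kernel.withDensity_rnDeriv_eq h]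
  set b : Y → ℝ≥0∞ := fun y => ∫⁻ a, geomMean (k y a) (l y a) ∂(η y)
  have hkl : Measurable (fun z : Y × A => geomMean (k z.1 z.2) (l z.1 z.2)) :=
    Measurable.geomMean hk hl
  have hb : Measurable b := hkl.lintegral_kernel_prod_right'
  have hb1 : ∀ y, b y ≤ 1 := fun y => by
    have : b y = hellingerAffinity (κ y) (ξ y) :=
      (hellingerAffinity_eq_lintegral (hk.comp measurable_prodMk_left)
        (hl.comp measurable_prodMk_left) (hκ y) (hξ y)).symm
    exact this.trans_le (hellingerAffinity_le_one _ _)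
  have e1 : hellingerAffinity (μ.map T ⊗ₘ κ) (ν.map T ⊗ₘ ξ) =
      ∫⁻ y, geomMean (u y) (v y) * b y ∂M' := by
    rw [hellingerAffinity_eq_lintegral (m := M' ⊗ₘ η) ((hu.comp measurable_fst).mul hk)
      ((hv.comp measurable_fst).mul hl) (withDensity_compProd_withDensity hu hk hμ' hκ)
      (withDensity_compProd_withDensity hv hl hν' hξ)]
    have hg : Measurable fun z : Y × A => geomMean (u z.1 * k z.1 z.2) (v z.1 * l z.1 z.2) :=
      ((hu.comp measurable_fst).mul hk).geomMean ((hv.comp measurable_fst).mul hl)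
    refine (Measure.lintegral_compProd hg).trans (lintegral_congr fun y => ?_)
    simp only [geomMean_mul_mul]
    exact lintegral_const_mul _ (hkl.comp measurable_prodMk_left)
  have hT' : Measurable fun z : X × A => (T z.1, z.2) := by fun_prop
  have hkT : Measurable (Function.uncurry fun x a => k (T x) a) := hk.comp hT'
  have hlT : Measurable (Function.uncurry fun x a => l (T x) a) := hl.comp hT'
  have e2 : hellingerAffinity (μ ⊗ₘ κ.comap T hT) (ν ⊗ₘ ξ.comap T hT) =
      ∫⁻ x, geomMean (p x) (q x) * b (T x) ∂M := by
    rw [hellingerAffinity_eq_lintegral (m := M ⊗ₘ η.comap T hT)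
      ((hp.comp measurable_fst).mul hkT) ((hq.comp measurable_fst).mul hlT)
      (withDensity_compProd_withDensity (κ := κ.comap T hT) hp hkT hμ fun x => hκ (T x))
      (withDensity_compProd_withDensity (κ := ξ.comap T hT) hq hlT hν fun x => hξ (T x))]
    have hg : Measurable fun z : X × A =>
        geomMean (p z.1 * k (T z.1) z.2) (q z.1 * l (T z.1) z.2) :=
      ((hp.comp measurable_fst).mul hkT).geomMean ((hq.comp measurable_fst).mul hlT)
    refine (Measure.lintegral_compProd hg).trans (lintegral_congr fun x => ?_)
    simp only [geomMean_mul_mul]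
    exact lintegral_const_mul _ (hkl.comp measurable_prodMk_left)
  have hsplit : hellingerAffinity μ ν =
      ∫⁻ x, geomMean (p x) (q x) * (1 - b (T x)) ∂M + ∫⁻ x, geomMean (p x) (q x) * b (T x) ∂M := by
    rw [← lintegral_add_left (by fun_prop)]
    refine lintegral_congr fun x => ?_
    rw [← mul_add, tsub_add_cancel_of_le (hb1 _), mul_one]
  have hsplit' : hellingerAffinity (μ.map T) (ν.map T) =
      ∫⁻ y, geomMean (u y) (v y) * (1 - b y) ∂M' + ∫⁻ y, geomMean (u y) (v y) * b y ∂M' := by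
    rw [← lintegral_add_left (by fun_prop)]
    refine lintegral_congr fun x => ?_
    rw [← mul_add, tsub_add_cancel_of_le (hb1 _), mul_one]
  have hw := lintegral_geomMean_mul_comp_le hT hp hq hμ hν hu hv hμ' hν'
    (φ := fun y => 1 - b y) (measurable_const.sub hb)
  rw [e1, e2, hsplit, add_right_comm]
  gcongr
  exact (add_le_add_left hw _).trans (hsplit'.symm.trans_le (hellingerAffinity_le_one _ _))

end Affinity

section JensenShannon
variable {X : Type*} [MeasurableSpace X] (μ ν : Measure X)

/-- If the density of `μ` with respect to `M` is bounded then the Kullback-Leibler divergence is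
a nonnegative finite integral against `M`. -/
lemma klDiv_eq_of_rnDeriv_le {μ M : Measure X} [IsProbabilityMeasure μ] [IsProbabilityMeasure M]
    (hμ : μ ≪ M) {c : ℝ} (hc : ∀ᵐ x ∂M, (μ.rnDeriv M x).toReal ≤ c) :
    Integrable (fun x => (μ.rnDeriv M x).toReal * Real.log (μ.rnDeriv M x).toReal) M ∧
    0 ≤ ∫ x, (μ.rnDeriv M x).toReal * Real.log (μ.rnDeriv M x).toReal ∂M ∧
    klDiv μ M =
      ENNReal.ofReal (∫ x, (μ.rnDeriv M x).toReal * Real.log (μ.rnDeriv M x).toReal ∂M) := by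
  have hp : Measurable fun x => (μ.rnDeriv M x).toReal :=
    (Measure.measurable_rnDeriv μ M).ennreal_toReal
  have hint : Integrable (fun x => (μ.rnDeriv M x).toReal * Real.log (μ.rnDeriv M x).toReal) M := by
    obtain ⟨C, hC⟩ := (isCompact_Icc (a := (0 : ℝ)) (b := c)).exists_bound_of_continuousOn
      Real.continuous_mul_log.continuousOn
    refine Integrable.of_bound (hp.mul hp.log).aestronglyMeasurable C ?_
    filter_upwards [hc] with x hx using hC _ ⟨ENNReal.toReal_nonneg, hx⟩
  have hint' : Integrable (fun x => Real.log (μ.rnDeriv M x).toReal) μ :=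
    (integrable_rnDeriv_smul_iff hμ).1 hint
  refine ⟨hint, ?_, ?_⟩
  · have hip : Integrable (fun x => (μ.rnDeriv M x).toReal) M := Measure.integrable_toReal_rnDeriv
    have h0 : ∫ x, ((μ.rnDeriv M x).toReal - 1) ∂M = 0 := by
      rw [integral_sub hip (integrable_const 1), Measure.integral_toReal_rnDeriv hμ]
      simp
    rw [← h0]
    refine integral_mono (hip.sub (integrable_const 1)) hint fun x => ?_
    exact Real.self_sub_one_le_mul_log ENNReal.toReal_nonneg
  · rw [klDiv, if_pos ⟨hμ, hint'⟩]
    congr 1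
    exact (integral_rnDeriv_smul hμ).symm

variable [IsProbabilityMeasure μ] [IsProbabilityMeasure ν]

lemma rnDeriv_midMeasure_add : ∀ᵐ x ∂(midMeasure μ ν),
    (μ.rnDeriv (midMeasure μ ν) x).toReal + (ν.rnDeriv (midMeasure μ ν) x).toReal = 2 := by
  set M := midMeasure μ ν
  have hp := Measure.measurable_rnDeriv μ M
  have hq := Measure.measurable_rnDeriv ν M
  have h : μ.rnDeriv M + ν.rnDeriv M =ᵐ[M] fun _ => 2 := by
    rw [← withDensity_eq_iff_of_sigmaFinite (hp.add hq).aemeasurable aemeasurable_const,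
      withDensity_add_left hp, withDensity_rnDeriv_midMeasure_left,
      withDensity_rnDeriv_midMeasure_right, withDensity_const]
    simp only [M, midMeasure]
    rw [smul_smul, ENNReal.mul_inv_cancel (by simp) (by simp), one_smul]
  filter_upwards [h, Measure.rnDeriv_ne_top μ M, Measure.rnDeriv_ne_top ν M] with x hx h1 h2
  rw [← ENNReal.toReal_add h1 h2, show μ.rnDeriv M x + ν.rnDeriv M x = 2 from hx]
  simp

lemma ae_rnDeriv_midMeasure : ∀ᵐ x ∂(midMeasure μ ν),
    |(μ.rnDeriv (midMeasure μ ν) x).toReal - 1| ≤ 1 ∧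
      (ν.rnDeriv (midMeasure μ ν) x).toReal = 2 - (μ.rnDeriv (midMeasure μ ν) x).toReal := by
  filter_upwards [rnDeriv_midMeasure_add μ ν] with x hx
  have h1 : 0 ≤ (μ.rnDeriv (midMeasure μ ν) x).toReal := ENNReal.toReal_nonneg
  have h2 : 0 ≤ (ν.rnDeriv (midMeasure μ ν) x).toReal := ENNReal.toReal_nonneg
  exact ⟨abs_le.2 ⟨by linarith, by linarith⟩, by linarith⟩

lemma jsDiv_eq_ofReal_integral :
    Integrable (fun x => jsIntegrand ((μ.rnDeriv (midMeasure μ ν) x).toReal - 1))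
      (midMeasure μ ν) ∧
    jsDiv μ ν = ENNReal.ofReal
      (∫ x, jsIntegrand ((μ.rnDeriv (midMeasure μ ν) x).toReal - 1) ∂(midMeasure μ ν)) := by
  set M := midMeasure μ ν with hM
  have hae := ae_rnDeriv_midMeasure μ ν
  obtain ⟨i1, n1, e1⟩ := klDiv_eq_of_rnDeriv_le (c := 2)
    (absolutelyContinuous_midMeasure_left μ ν)
    (hae.mono fun x hx => by linarith [(abs_le.1 hx.1).2])
  obtain ⟨i2, n2, e2⟩ := klDiv_eq_of_rnDeriv_le (c := 2)
    (absolutelyContinuous_midMeasure_right μ ν)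
    (hae.mono fun x hx => by linarith [(abs_le.1 hx.1).1, hx.2])
  rw [← hM] at i1 n1 e1 i2 n2 e2 hae
  have heq : (fun x => ((μ.rnDeriv M x).toReal * Real.log (μ.rnDeriv M x).toReal +
      (ν.rnDeriv M x).toReal * Real.log (ν.rnDeriv M x).toReal) / 2) =ᵐ[M]
      fun x => jsIntegrand ((μ.rnDeriv M x).toReal - 1) := by
    filter_upwards [hae] with x hx
    rw [hx.2, jsIntegrand]
    ring_nf
  refine ⟨((i1.add i2).div_const 2).congr heq, ?_⟩
  rw [jsDiv, ← midMeasure, ← hM, e1, e2, ← integral_congr_ae heq, integral_div,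
    integral_add i1 i2, ← mul_add, ← ENNReal.ofReal_add n1 n2, div_eq_inv_mul,
    ENNReal.ofReal_mul (by norm_num), ENNReal.ofReal_inv_of_pos (by norm_num)]
  simp

lemma one_sub_hellingerAffinity_eq_ofReal_integral :
    Integrable (fun x => 1 - √(1 - ((μ.rnDeriv (midMeasure μ ν) x).toReal - 1) ^ 2))
      (midMeasure μ ν) ∧
    1 - hellingerAffinity μ ν = ENNReal.ofReal
      (∫ x, (1 - √(1 - ((μ.rnDeriv (midMeasure μ ν) x).toReal - 1) ^ 2)) ∂(midMeasure μ ν)) := by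
  set M := midMeasure μ ν with hM
  have hp : Measurable fun x => (μ.rnDeriv M x).toReal :=
    (Measure.measurable_rnDeriv μ M).ennreal_toReal
  have hint : Integrable (fun x => √(1 - ((μ.rnDeriv M x).toReal - 1) ^ 2)) M := by
    refine Integrable.of_bound
      (measurable_const.sub ((hp.sub_const 1).pow_const 2)).sqrt.aestronglyMeasurable 1 (ae_of_all _ fun x => ?_)
    rw [Real.norm_of_nonneg (Real.sqrt_nonneg _)]
    exact Real.sqrt_le_one.2 (by nlinarith [sq_nonneg ((μ.rnDeriv M x).toReal - 1)])
  refine ⟨(integrable_const 1).sub hint, ?_⟩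
  rw [integral_sub (integrable_const 1) hint,
    ENNReal.ofReal_sub _ (integral_nonneg fun x => Real.sqrt_nonneg _),
    ofReal_integral_eq_lintegral_ofReal hint (ae_of_all _ fun x => Real.sqrt_nonneg _)]
  simp only [integral_const, probReal_univ, smul_eq_mul, mul_one, ENNReal.ofReal_one]
  congr 1
  refine lintegral_congr_ae ?_
  filter_upwards [ae_rnDeriv_midMeasure μ ν, Measure.rnDeriv_ne_top μ M,
    Measure.rnDeriv_ne_top ν M] with x hx h1 h2
  rw [← hM] at hx ⊢
  have e : 1 - ((μ.rnDeriv M x).toReal - 1) ^ 2 =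
      (μ.rnDeriv M x).toReal * (ν.rnDeriv M x).toReal := by rw [hx.2]; ring
  rw [e, ← ENNReal.toReal_mul, Real.sqrt_eq_rpow, ENNReal.toReal_rpow,
    ENNReal.ofReal_toReal (ENNReal.rpow_ne_top_of_nonneg (by norm_num) (ENNReal.mul_ne_top h1 h2)),
    geomMean]
  norm_num

lemma jsDiv_le_one_sub_hellingerAffinity : jsDiv μ ν ≤ 1 - hellingerAffinity μ ν := by
  obtain ⟨i1, e1⟩ := jsDiv_eq_ofReal_integral μ ν
  obtain ⟨i2, e2⟩ := one_sub_hellingerAffinity_eq_ofReal_integral μ ν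
  rw [e1, e2]
  refine ENNReal.ofReal_le_ofReal (integral_mono_ae i1 i2 ?_)
  filter_upwards [ae_rnDeriv_midMeasure μ ν] with x hx using jsIntegrand_le hx.1

lemma one_sub_hellingerAffinity_le_jsDiv :
    1 - hellingerAffinity μ ν ≤ ENNReal.ofReal (1 / Real.log 2) * jsDiv μ ν := by
  obtain ⟨i1, e1⟩ := jsDiv_eq_ofReal_integral μ ν
  obtain ⟨i2, e2⟩ := one_sub_hellingerAffinity_eq_ofReal_integral μ ν
  have hc : 0 < Real.log 2 := Real.log_pos one_lt_two
  rw [e1, e2, ← ENNReal.ofReal_mul (by positivity), ← integral_const_mul]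
  refine ENNReal.ofReal_le_ofReal (integral_mono_ae i2 (i1.const_mul _) ?_)
  filter_upwards [ae_rnDeriv_midMeasure μ ν] with x hx
  rw [one_div, inv_mul_eq_div, le_div_iff₀' hc]
  exact log_two_mul_le_jsIntegrand hx.1

end JensenShannon

section BayesNet

/-- Data processing for pushforwards: the affinity increases when `f` is post-composed with a
measurable map. -/
lemma hellingerAffinity_map_le_map {X Y Z : Type*} [MeasurableSpace X] [MeasurableSpace Y]
    [MeasurableSpace Z] (P Q : Measure X) [IsProbabilityMeasure P] [IsProbabilityMeasure Q]
    {f : X → Y} (hf : Measurable f) {T : Y → Z} (hT : Measurable T) {g : X → Z}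
    (hg : ∀ x, T (f x) = g x) :
    hellingerAffinity (P.map f) (Q.map f) ≤ hellingerAffinity (P.map g) (Q.map g) := by
  have := Measure.isProbabilityMeasure_map (μ := P) hf.aemeasurable
  have := Measure.isProbabilityMeasure_map (μ := Q) hf.aemeasurable
  have h := hellingerAffinity_le_map (P.map f) (Q.map f) hT
  rwa [Measure.map_map hT hf, Measure.map_map hT hf, show T ∘ f = g from funext hg] at h

/-- If `g` and `f` are conditionally independent given `h`, under both `P` and `Q`, then the squared
Hellinger distance of the joint laws is at most the sum of those of `(h, g)` and `(h, f)`. -/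
lemma hellingerAffinity_add_le_of_condIndepFun {X A B C : Type*} [MeasurableSpace X]
    [StandardBorelSpace X] [MeasurableSpace A] [StandardBorelSpace A] [Nonempty A]
    [MeasurableSpace B] [StandardBorelSpace B] [Nonempty B] [MeasurableSpace C]
    (P Q : Measure X) [IsProbabilityMeasure P] [IsProbabilityMeasure Q]
    {f : X → A} {g : X → B} {h : X → C} (hf : Measurable f) (hg : Measurable g)
    (hh : Measurable h)
    (hP : CondIndepFun (MeasurableSpace.comap h inferInstance) hh.comap_le f g P)
    (hQ : CondIndepFun (MeasurableSpace.comap h inferInstance) hh.comap_le f g Q) :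
    hellingerAffinity (P.map fun x => (h x, g x)) (Q.map fun x => (h x, g x)) +
        hellingerAffinity (P.map fun x => (h x, f x)) (Q.map fun x => (h x, f x)) ≤
      1 + hellingerAffinity (P.map fun x => ((h x, g x), f x))
        (Q.map fun x => ((h x, g x), f x)) := by
  have hhg : Measurable fun x => (h x, g x) := hh.prodMk hg
  have := Measure.isProbabilityMeasure_map (μ := P) hhg.aemeasurable
  have := Measure.isProbabilityMeasure_map (μ := Q) hhg.aemeasurable
  have joint : ∀ (R : Measure X) [IsProbabilityMeasure R],
      CondIndepFun (MeasurableSpace.comap h inferInstance) hh.comap_le f g R →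
      R.map (fun x => ((h x, g x), f x)) =
        R.map (fun x => (h x, g x)) ⊗ₘ (condDistrib f h R).comap Prod.fst measurable_fst :=
    fun R _ hR => (condDistrib_ae_eq_iff_measure_eq_compProd _ hf.aemeasurable _).1
      ((condIndepFun_iff_condDistrib_prod_ae_eq_prodMkRight hf hg hh).1 hR.symm)
  have marg : ∀ (R : Measure X) [IsProbabilityMeasure R], R.map (fun x => (h x, f x)) =
      (R.map (fun x => (h x, g x))).map Prod.fst ⊗ₘ condDistrib f h R := by
    intro R _
    rw [Measure.map_map measurable_fst hhg]
    exact (compProd_map_condDistrib hf.aemeasurable).symm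
  rw [joint P hP, joint Q hQ, marg P, marg Q]
  exact hellingerAffinity_add_le _ _ measurable_fst _ _

variable {n : ℕ} {Ω : Fin n → Type*} [∀ i, MeasurableSpace (Ω i)]

lemma measurable_restrict_subset {S S' : Finset (Fin n)} (h : S ⊆ S') :
    Measurable fun (y : ∀ j : S', Ω j) (j : S) => y ⟨j, h j.2⟩ :=
  measurable_pi_lambda _ fun _ => measurable_pi_apply _

variable [∀ i, StandardBorelSpace (Ω i)] [∀ i, Nonempty (Ω i)]

lemma one_sub_hellingerAffinity_prefix_succ_le {par : Fin n → Finset (Fin n)}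
    (hpar : ∀ i, par i ⊆ Finset.Iio i) (P Q : Measure (∀ i, Ω i)) [IsProbabilityMeasure P]
    [IsProbabilityMeasure Q] (hP : IsBayesNet P par) (hQ : IsBayesNet Q par) (i : Fin n) :
    1 - hellingerAffinity (P.map (proj {j : Fin n | j.val < i.val + 1}))
        (Q.map (proj {j : Fin n | j.val < i.val + 1})) ≤
      (1 - hellingerAffinity (P.map (proj {j : Fin n | j.val < i.val}))
        (Q.map (proj {j : Fin n | j.val < i.val}))) +
      (1 - hellingerAffinity (P.map (proj (insert i (par i))))
        (Q.map (proj (insert i (par i))))) := by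
  have hmem : ∀ {j : Fin n} {k : ℕ},
      j ∈ ({j : Fin n | j.val < k} : Finset (Fin n)) ↔ j.val < k := by simp
  have key := hellingerAffinity_add_le_of_condIndepFun P Q (measurable_pi_apply i)
    (measurable_proj (Finset.Iio i)) (measurable_proj (par i)) (hP i) (hQ i)
  have hIio : Finset.Iio i ⊆ ({j : Fin n | j.val < i.val} : Finset (Fin n)) := by
    intro j hj; simpa using hj
  have h1 := hellingerAffinity_map_le_map P Q (measurable_proj {j : Fin n | j.val < i.val})
    ((measurable_restrict_subset ((hpar i).trans hIio)).prodMk (measurable_restrict_subset hIio))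
    (g := fun x => (proj (par i) x, proj (Finset.Iio i) x)) fun x => rfl
  have h2 := hellingerAffinity_map_le_map P Q (measurable_proj (insert i (par i)))
    ((measurable_restrict_subset (Finset.subset_insert i (par i))).prodMk
      (measurable_pi_apply ⟨i, Finset.mem_insert_self i (par i)⟩))
    (g := fun x => (proj (par i) x, x i)) fun x => rfl
  let T : ((∀ j : par i, Ω j) × (∀ j : Finset.Iio i, Ω j)) × Ω i →
      ∀ j : ({j : Fin n | j.val < i.val + 1} : Finset (Fin n)), Ω j := fun y j =>
    if hj : j.1 = i then cast (congrArg Ω hj.symm) y.2 else y.1.2 ⟨j.1, by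
      have := hmem.1 j.2
      rw [Finset.mem_Iio, Fin.lt_def]
      have := Fin.val_ne_of_ne hj
      omega⟩
  have hT : Measurable T := by
    refine measurable_pi_lambda _ fun ⟨j, hj⟩ => ?_
    by_cases h : j = i
    · subst h
      simp only [T, dite_true, cast_eq]
      exact measurable_snd
    · simp only [T, dif_neg h]
      fun_prop
  have h3 := hellingerAffinity_map_le_map P Q
    (((measurable_proj (par i)).prodMk (measurable_proj (Finset.Iio i))).prodMk
      (measurable_pi_apply i)) hT
    (g := proj {j : Fin n | j.val < i.val + 1}) (by
      intro x
      ext ⟨j, hj⟩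
      by_cases h : j = i
      · subst h
        simp [T, proj]
      · simp [T, proj, h])
  have := Measure.isProbabilityMeasure_map (μ := P)
    (measurable_proj (Ω := Ω) {j : Fin n | j.val < i.val}).aemeasurable
  have := Measure.isProbabilityMeasure_map (μ := Q)
    (measurable_proj (Ω := Ω) {j : Fin n | j.val < i.val}).aemeasurable
  have := Measure.isProbabilityMeasure_map (μ := P)
    (measurable_proj (Ω := Ω) (insert i (par i))).aemeasurable
  have := Measure.isProbabilityMeasure_map (μ := Q)
    (measurable_proj (Ω := Ω) (insert i (par i))).aemeasurable
  have b1 := hellingerAffinity_le_one (P.map (proj {j : Fin n | j.val < i.val}))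
    (Q.map (proj {j : Fin n | j.val < i.val}))
  have b2 := hellingerAffinity_le_one (P.map (proj (insert i (par i))))
    (Q.map (proj (insert i (par i))))
  have step := (add_le_add h1 h2).trans (key.trans (add_le_add_right h3 1))
  rw [tsub_le_iff_right]
  refine (ENNReal.add_le_add_iff_left ENNReal.one_ne_top).1 ?_
  refine le_trans ?_ ((add_le_add_right step _).trans_eq (add_left_comm _ _ _))
  rw [add_add_add_comm, tsub_add_cancel_of_le b1, tsub_add_cancel_of_le b2]

/-- Subadditivity of the squared Hellinger distance on Bayes-nets. -/
lemma one_sub_hellingerAffinity_le_sum {par : Fin n → Finset (Fin n)}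
    (hpar : ∀ i, par i ⊆ Finset.Iio i) (P Q : Measure (∀ i, Ω i)) [IsProbabilityMeasure P]
    [IsProbabilityMeasure Q] (hP : IsBayesNet P par) (hQ : IsBayesNet Q par) :
    1 - hellingerAffinity P Q ≤ ∑ i : Fin n, (1 - hellingerAffinity
      (P.map (proj (insert i (par i)))) (Q.map (proj (insert i (par i))))) := by
  let h : ℕ → ℝ≥0∞ := fun k => if hk : k < n then 1 - hellingerAffinity
      (P.map (proj (insert ⟨k, hk⟩ (par ⟨k, hk⟩)))) (Q.map (proj (insert ⟨k, hk⟩ (par ⟨k, hk⟩))))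
    else 0
  have hind : ∀ k ≤ n, 1 - hellingerAffinity (P.map (proj {j : Fin n | j.val < k}))
      (Q.map (proj {j : Fin n | j.val < k})) ≤ ∑ j ∈ Finset.range k, h j := by
    intro k
    induction k with
    | zero =>
      intro _
      have hm := measurable_proj (Ω := Ω) {j : Fin n | j.val < 0}
      have := Measure.isProbabilityMeasure_map (μ := P) hm.aemeasurable
      have := Measure.isProbabilityMeasure_map (μ := Q) hm.aemeasurable
      have : IsEmpty ({j : Fin n | j.val < 0} : Finset (Fin n)) :=
        ⟨fun j => absurd (Finset.mem_filter.1 j.2).2 (Nat.not_lt_zero _)⟩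
      have heq : P.map (proj {j : Fin n | j.val < 0}) = Q.map (proj {j : Fin n | j.val < 0}) := by
        ext s _
        rcases s.eq_empty_or_nonempty with rfl | hs
        · simp
        · rw [Subsingleton.eq_univ_of_nonempty hs, measure_univ, measure_univ]
      rw [heq, hellingerAffinity_self]
      simp
    | succ k ih =>
      intro hk
      rw [Finset.sum_range_succ]
      refine (one_sub_hellingerAffinity_prefix_succ_le hpar P Q hP hQ ⟨k, hk⟩).trans ?_
      refine add_le_add (ih (Nat.le_of_succ_le hk)) (le_of_eq ?_)
      simp only [h, dif_pos (Nat.lt_of_succ_le hk)]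
  have hlast := hellingerAffinity_map_le_map P Q (measurable_proj {j : Fin n | j.val < n})
    (T := fun y j => y ⟨j, by simp⟩)
    (measurable_pi_lambda _ fun _ => measurable_pi_apply _) (g := id) fun x => rfl
  rw [Measure.map_id, Measure.map_id] at hlast
  refine (tsub_le_tsub_left hlast 1).trans ((hind n le_rfl).trans_eq ?_)
  rw [Finset.sum_range]
  exact Finset.sum_congr rfl fun i _ => dif_pos i.2

end BayesNet

/-- `(1/ln 2)`-linear subadditivity of the Jensen-Shannon divergence (with natural
logarithm) on Bayes-nets. -/
theorem jsDiv_linear_subadditivity_bayes_net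
    {n : ℕ} (Ω : Fin n → Type u) [∀ i, MeasurableSpace (Ω i)]
    [∀ i, StandardBorelSpace (Ω i)] [∀ i, Nonempty (Ω i)]
    (par : Fin n → Finset (Fin n)) (hpar : ∀ i, par i ⊆ Finset.Iio i)
    (P Q : Measure (∀ i, Ω i)) [IsProbabilityMeasure P] [IsProbabilityMeasure Q]
    (hP : IsBayesNet P par) (hQ : IsBayesNet Q par) :
    jsDiv P Q ≤ ENNReal.ofReal (1 / Real.log 2) * ∑ i : Fin n,
      jsDiv (P.map (proj (insert i (par i)))) (Q.map (proj (insert i (par i)))) := by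
  refine (jsDiv_le_one_sub_hellingerAffinity P Q).trans
    ((one_sub_hellingerAffinity_le_sum hpar P Q hP hQ).trans ?_)
  rw [Finset.mul_sum]
  refine Finset.sum_le_sum fun i _ => ?_
  have := Measure.isProbabilityMeasure_map (μ := P)
    (measurable_proj (Ω := Ω) (insert i (par i))).aemeasurable
  have := Measure.isProbabilityMeasure_map (μ := Q)
    (measurable_proj (Ω := Ω) (insert i (par i))).aemeasurable
  exact one_sub_hellingerAffinity_le_jsDiv _ _
end
end
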